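/- Let R be a commutative Noetherian ring and a, b ideals of R such that R/b has finite dimension d > 0. Then for any finitely generated R-module M with Assh_R M = Assh_R(R/b) and any m ∈ P_{a,R/b}, the localization (H^d_a(M))_m is not a finitely generated R_m-module. -/

import Mathlib

/- Common definitions: local cohomology modules, cohomological dimension, module dimension,
secondary representations and attached primes. -/

open CategoryTheory TensorProduct

/-- The `i`-th local cohomology module `H^i_a(M)`, as a type with its `R`-module structure. -/
noncomputable def TopLC (R : Type) [CommRing R] (a : Ideal R) (i : ℕ)
    (M : Type) [AddCommGroup M] [Module R M] : Type :=
  ((localCohomology a i).obj (ModuleCat.of R M))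

noncomputable instance (R : Type) [CommRing R] (a : Ideal R) (i : ℕ)
    (M : Type) [AddCommGroup M] [Module R M] : AddCommGroup (TopLC R a i M) :=
  inferInstanceAs (AddCommGroup ((localCohomology a i).obj (ModuleCat.of R M)))

noncomputable instance (R : Type) [CommRing R] (a : Ideal R) (i : ℕ)
    (M : Type) [AddCommGroup M] [Module R M] : Module R (TopLC R a i M) :=
  inferInstanceAs (Module R ((localCohomology a i).obj (ModuleCat.of R M)))

/-- The cohomological dimension `cd_R(a, M) = sup { i | H^i_a(M) ≠ 0 }`,
with value `⊥` if all local cohomology modules vanish. -/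
noncomputable def cohDim (R : Type) [CommRing R] (a : Ideal R)
    (M : Type) [AddCommGroup M] [Module R M] : WithBot ℕ∞ :=
  sSup {n : WithBot ℕ∞ | ∃ i : ℕ, n = (i : ℕ) ∧ Nontrivial (TopLC R a i M)}

/-- The (Krull) dimension of a module, i.e. the Krull dimension of its support. -/
noncomputable def moduleDim (R : Type) [CommRing R]
    (M : Type) [AddCommGroup M] [Module R M] : WithBot ℕ∞ :=
  Order.krullDim (Module.support R M)

/-- `Assh_R M`: the associated primes `p` of `M` with `dim R/p = dim M`. -/
noncomputable def Assh (R : Type) [CommRing R]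
    (M : Type) [AddCommGroup M] [Module R M] : Set (Ideal R) :=
  { p | p ∈ associatedPrimes R M ∧ ringKrullDim (R ⧸ p) = moduleDim R M }

/-- A submodule `S` is secondary if `S ≠ 0` and every `r : R` acts on `S` either
surjectively or nilpotently. -/
def IsSecondarySub (R : Type) [CommRing R] {M : Type} [AddCommGroup M] [Module R M]
    (S : Submodule R M) : Prop :=
  S ≠ ⊥ ∧ ∀ r : R, (∀ m ∈ S, ∃ s ∈ S, r • s = m) ∨ (∃ n : ℕ, ∀ m ∈ S, r ^ n • m = 0)

/-- A module is representable if it is the (finite) sum of secondary submodules. -/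
def IsRepresentable (R : Type) [CommRing R] (M : Type) [AddCommGroup M] [Module R M] : Prop :=
  ∃ (n : ℕ) (S : Fin n → Submodule R M), (∀ i, IsSecondarySub R (S i)) ∧ (⨆ i, S i) = ⊤

/-- A minimal secondary representation: secondary submodules summing to the whole module,
with pairwise distinct attached primes, none contained in the sum of the others. -/
def IsMinimalRep (R : Type) [CommRing R] {M : Type} [AddCommGroup M] [Module R M]
    {n : ℕ} (S : Fin n → Submodule R M) : Prop :=
  (∀ i, IsSecondarySub R (S i)) ∧ (⨆ i, S i) = ⊤ ∧
    (Function.Injective fun i => (S i).annihilator.radical) ∧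
    ∀ j, ¬ (S j ≤ ⨆ i ∈ ({j}ᶜ : Set (Fin n)), S i)

/-- The attached primes of a module: the radicals of the annihilators of the terms of a
minimal secondary representation. -/
def AttachedPrimes (R : Type) [CommRing R] (M : Type) [AddCommGroup M] [Module R M] :
    Set (Ideal R) :=
  { p | ∃ (n : ℕ) (S : Fin n → Submodule R M), IsMinimalRep R S ∧
      ∃ i, p = (S i).annihilator.radical }

/-- `stab b N = ⟨b⟩N = ⋂ₙ bⁿN`. -/
def stab {R M : Type} [CommRing R] [AddCommGroup M] [Module R M]
    (b : Ideal R) (N : Submodule R M) : Submodule R M :=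
  ⨅ n : ℕ, b ^ n • N

/-- The set `P_{a,M}` of primes `p ⊇ Ann M + a` for which there is a prime `p*` in the
support of the completed localization `(M_p)^` over `(R_p)^` with `dim (R_p)^/p* = d`
and `dim (R_p)^/(a (R_p)^ + p*) = 0`. -/
noncomputable def Pset (R : Type) [CommRing R] (a : Ideal R)
    (M : Type) [AddCommGroup M] [Module R M] (d : ℕ) : Set (PrimeSpectrum R) :=
  fun p =>
    Module.annihilator R M ⊔ a ≤ p.asIdeal ∧
    ∃ q : PrimeSpectrum (AdicCompletion
        (IsLocalRing.maximalIdeal (Localization.AtPrime p.asIdeal))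
        (Localization.AtPrime p.asIdeal)),
      q ∈ Module.support
          (AdicCompletion (IsLocalRing.maximalIdeal (Localization.AtPrime p.asIdeal))
            (Localization.AtPrime p.asIdeal))
          (AdicCompletion (IsLocalRing.maximalIdeal (Localization.AtPrime p.asIdeal))
            (LocalizedModule p.asIdeal.primeCompl M)) ∧
      ringKrullDim (AdicCompletion (IsLocalRing.maximalIdeal (Localization.AtPrime p.asIdeal))
          (Localization.AtPrime p.asIdeal) ⧸ q.asIdeal) = (d : WithBot ℕ∞) ∧
      ringKrullDim (AdicCompletion (IsLocalRing.maximalIdeal (Localization.AtPrime p.asIdeal))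
          (Localization.AtPrime p.asIdeal) ⧸
          (Ideal.map (algebraMap (Localization.AtPrime p.asIdeal)
              (AdicCompletion (IsLocalRing.maximalIdeal (Localization.AtPrime p.asIdeal))
                (Localization.AtPrime p.asIdeal)))
            (Ideal.map (algebraMap R (Localization.AtPrime p.asIdeal)) a) ⊔ q.asIdeal)) =
        (0 : WithBot ℕ∞)

/-- If every element of `X` is killed by a power of `r` and the kernel of `r` is Artinian,
then `X` is Artinian. -/
theorem isArtinian_of_ker_smul {S X : Type*} [CommRing S] [AddCommGroup X] [Module S X] (r : S)
    (htors : ∀ x : X, ∃ k : ℕ, r ^ k • x = 0)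
    [IsArtinian S (LinearMap.ker (LinearMap.lsmul S X r))] : IsArtinian S X := by
  rw [← monotone_stabilizes_iff_artinian]
  intro f
  set F : ℕ → Submodule S X := fun n => OrderDual.ofDual (f n) with hF
  have hFanti : ∀ {i j}, i ≤ j → F j ≤ F i := fun h => f.monotone h
  set K := LinearMap.ker (LinearMap.lsmul S X r)
  let Y : ℕ → ℕ → Submodule S K := fun j k =>
    ((F j ⊓ LinearMap.ker (LinearMap.lsmul S X (r ^ (k + 1)))).map
      (LinearMap.lsmul S X (r ^ k))).comap K.subtype
  have hY : ∀ j k (x : K), x ∈ Y j k ↔ ∃ y ∈ F j, r ^ k • y = x := by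
    intro j k x
    simp only [Y, Submodule.mem_comap, Submodule.mem_map, Submodule.mem_inf, LinearMap.mem_ker,
      LinearMap.lsmul_apply, Submodule.subtype_apply]
    refine ⟨fun ⟨y, hy, e⟩ => ⟨y, hy.1, e⟩, fun ⟨y, hy, e⟩ => ⟨y, ⟨hy, ?_⟩, e⟩⟩
    have := x.2
    rw [pow_succ', mul_smul, e]
    rwa [LinearMap.mem_ker, LinearMap.lsmul_apply] at this
  have hYj : ∀ {i j} k, i ≤ j → Y j k ≤ Y i k := by
    intro i j k h x hx
    rw [hY] at hx ⊢
    obtain ⟨y, hy, e⟩ := hx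
    exact ⟨y, hFanti h hy, e⟩
  have hYk1 : ∀ j k, Y j (k + 1) ≤ Y j k := by
    intro j k x hx
    rw [hY] at hx ⊢
    obtain ⟨y, hy, e⟩ := hx
    exact ⟨r • y, (F j).smul_mem r hy, by rw [← e, pow_succ, mul_smul]⟩
  have hYk : ∀ j, Antitone (Y j) := fun j => antitone_nat_of_succ_le (hYk1 j)
  obtain ⟨_, ⟨⟨j0, k0⟩, rfl⟩, hmin⟩ := WellFounded.has_min
    (wellFounded_lt : WellFounded ((· < ·) : Submodule S K → Submodule S K → Prop))
    (Set.range fun p : ℕ × ℕ => Y p.1 p.2) ⟨_, ⟨(0, 0), rfl⟩⟩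
  have h0 : ∀ j k, j0 ≤ j → k0 ≤ k → Y j k = Y j0 k0 := by
    intro j k hj hk
    by_contra hne
    exact hmin _ ⟨(j, k), rfl⟩ (lt_of_le_of_ne ((hYj k hj).trans (hYk j0 hk)) hne)
  have hst : ∀ k, ∃ n, ∀ j, n ≤ j → Y n k = Y j k := fun k =>
    IsArtinian.monotone_stabilizes (⟨fun j => OrderDual.toDual (Y j k), fun i j h => hYj k h⟩ :
      ℕ →o (Submodule S K)ᵒᵈ)
  choose n hn using hst
  let J := j0 ⊔ (Finset.range k0).sup n
  have hJ : ∀ j, J ≤ j → ∀ k, Y J k = Y j k := by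
    intro j hj k
    by_cases hk : k0 ≤ k
    · rw [h0 J k le_sup_left hk, h0 j k (le_sup_left.trans hj) hk]
    · have : n k ≤ J := le_trans (Finset.le_sup (f := n) (by simpa using hk)) le_sup_right
      rw [← hn k J this, hn k j (this.trans hj)]
  refine ⟨J, fun j hj => ?_⟩
  change F J = F j
  refine le_antisymm ?_ (hFanti hj)
  have key : ∀ k, ∀ x ∈ F J, r ^ k • x = 0 → x ∈ F j := by
    intro k
    induction k with
    | zero => intro x _ h; rw [pow_zero, one_smul] at h; rw [h]; exact zero_mem _
    | succ k ih =>
      intro x hx h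
      have hxK : r ^ k • x ∈ K := by
        simp only [K, LinearMap.mem_ker, LinearMap.lsmul_apply, ← mul_smul, ← pow_succ', h]
      have h1 : (⟨r ^ k • x, hxK⟩ : K) ∈ Y J k := (hY _ _ _).2 ⟨x, hx, rfl⟩
      rw [hJ j hj k] at h1
      obtain ⟨y, hy, e⟩ := (hY _ _ _).1 h1
      have h2 := ih (x - y) (sub_mem hx (hFanti hj hy)) (by rw [smul_sub, e]; simp)
      simpa using add_mem h2 hy
  intro x hx
  obtain ⟨k, hk⟩ := htors x
  exact key k x hx hk

/-- An Artinian module over a Noetherian local ring killed by a power of the maximal ideal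
is finite. -/
theorem finite_of_isArtinian_of_pow_smul {C Y : Type*} [CommRing C] [IsLocalRing C]
    [IsNoetherianRing C] [AddCommGroup Y] [Module C Y] [IsArtinian C Y] (k : ℕ)
    (hk : IsLocalRing.maximalIdeal C ^ k ≤ Module.annihilator C Y) : Module.Finite C Y := by
  rcases subsingleton_or_nontrivial Y with hs | hs
  · infer_instance
  set I := IsLocalRing.maximalIdeal C ^ k
  have ht : Module.IsTorsionBySet C Y I := by
    intro y a
    exact Module.mem_annihilator.1 (hk a.2) y
  let := ht.module
  have : IsScalarTower C (C ⧸ I) Y := ht.isScalarTower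
  have hI : I ≠ ⊤ := by
    intro h
    have h1 : (1 : C) ∈ Module.annihilator C Y := hk (by rw [h]; trivial)
    obtain ⟨y, hy⟩ := exists_ne (0 : Y)
    exact hy (by simpa using Module.mem_annihilator.1 h1 y)
  have : Nontrivial (C ⧸ I) := Ideal.Quotient.nontrivial_iff.2 hI
  have : IsLocalRing (C ⧸ I) :=
    IsLocalRing.of_surjective' (Ideal.Quotient.mk I) Ideal.Quotient.mk_surjective
  have : IsArtinianRing (C ⧸ I) := by
    rw [isArtinianRing_iff_isNilpotent_maximalIdeal]
    refine ⟨k, ?_⟩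
    have hm : IsLocalRing.maximalIdeal (C ⧸ I) =
        (IsLocalRing.maximalIdeal C).map (Ideal.Quotient.mk I) := by
      refine (IsLocalRing.eq_maximalIdeal ?_).symm
      have := Ideal.map_eq_top_or_isMaximal_of_surjective (Ideal.Quotient.mk I)
        Ideal.Quotient.mk_surjective (I := IsLocalRing.maximalIdeal C) inferInstance
      refine this.resolve_left fun h => ?_
      have h1 : IsLocalRing.maximalIdeal C ⊔ I = ⊤ := by
        have := congrArg (Ideal.comap (Ideal.Quotient.mk I)) h
        rwa [Ideal.comap_map_of_surjective _ Ideal.Quotient.mk_surjective, Ideal.comap_top,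
          ← RingHom.ker_eq_comap_bot, Ideal.mk_ker] at this
      have h2 : I ≤ IsLocalRing.maximalIdeal C := IsLocalRing.le_maximalIdeal hI
      rw [sup_eq_left.2 h2] at h1
      exact Ideal.IsMaximal.ne_top inferInstance h1
    rw [hm, ← Ideal.map_pow]
    exact Ideal.map_quotient_self I
  have : IsArtinian (C ⧸ I) Y := isArtinian_of_tower C inferInstance
  have : Module.Finite (C ⧸ I) Y := by
    have := (IsArtinianRing.tfae (R := C ⧸ I) (M := Y)).out 2 0
    exact this.1 inferInstance
  exact Module.Finite.trans (C ⧸ I) Y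

/-- For a sum-irreducible submodule of an Artinian module over a Noetherian local ring, either it is
finite, or there is a nonmaximal prime outside of which all elements act surjectively. -/
theorem SupIrred.finite_or_exists_prime {C X : Type*} [CommRing C] [IsLocalRing C]
    [IsNoetherianRing C] [AddCommGroup X] [Module C X] [IsArtinian C X] {Y : Submodule C X}
    (hY : SupIrred Y) : Module.Finite C Y ∨ ∃ p : Ideal C, p.IsPrime ∧
      p ≠ IsLocalRing.maximalIdeal C ∧ ∀ r ∉ p, Y ≤ Y.map (LinearMap.lsmul C X r) := by
  have hY0 : Y ≠ ⊥ := fun h => hY.1 (h ▸ isMin_bot)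
  have hle : ∀ r, Y.map (LinearMap.lsmul C X r) ≤ Y := by
    rintro r _ ⟨y, hy, rfl⟩
    exact Y.smul_mem r hy
  let p : Ideal C :=
    { carrier := {r | Y.map (LinearMap.lsmul C X r) ≠ Y}
      zero_mem' := by simpa using hY0.symm
      add_mem' := by
        intro r s hr hs h
        have : Y.map (LinearMap.lsmul C X r) ⊔ Y.map (LinearMap.lsmul C X s) = Y := by
          refine le_antisymm (sup_le (hle r) (hle s)) ?_
          intro y hy
          rw [← h] at hy
          obtain ⟨z, hz, rfl⟩ := hy
          rw [map_add]
          exact Submodule.add_mem_sup ⟨z, hz, rfl⟩ ⟨z, hz, rfl⟩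
        exact (hY.2 this).elim hr hs
      smul_mem' := by
        intro c r hr h
        refine hr (le_antisymm (hle r) fun y hy => ?_)
        rw [← h] at hy
        obtain ⟨z, hz, rfl⟩ := hy
        exact ⟨c • z, Y.smul_mem c hz, by simp [mul_smul, smul_comm c r]⟩ }
  have hpm : ∀ r, r ∈ p ↔ Y.map (LinearMap.lsmul C X r) ≠ Y := fun _ => Iff.rfl
  have hmul : ∀ r s, Y.map (LinearMap.lsmul C X (r * s)) =
      (Y.map (LinearMap.lsmul C X s)).map (LinearMap.lsmul C X r) := by
    intro r s
    rw [← Submodule.map_comp]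
    congr 1
    ext x
    simp [mul_smul, smul_comm r s]
  have hp : p.IsPrime := by
    refine ⟨?_, ?_⟩
    · rw [Ideal.ne_top_iff_one, hpm, not_not]
      ext x; simp
    · intro r s hrs
      by_contra! h
      rw [hpm, hpm, not_not, not_not] at h
      exact hrs (by rw [hmul, h.2, h.1])
  by_cases hpmax : p = IsLocalRing.maximalIdeal C
  swap
  · exact Or.inr ⟨p, hp, hpmax, fun r hr => by rw [hpm, not_not] at hr; exact hr.ge⟩
  left
  have hnil : ∀ r ∈ p, ∃ k : ℕ, r ^ k ∈ Module.annihilator C Y := by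
    intro r hr
    have hanti : Antitone fun k => Y.map (LinearMap.lsmul C X (r ^ k)) := by
      refine antitone_nat_of_succ_le fun k => ?_
      rw [pow_succ, hmul]
      exact Submodule.map_mono (hle r)
    obtain ⟨k, hk⟩ := IsArtinian.monotone_stabilizes
      (⟨fun k => OrderDual.toDual (Y.map (LinearMap.lsmul C X (r ^ k))), fun i j h => hanti h⟩ :
      ℕ →o (Submodule C X)ᵒᵈ)
    replace hk : ∀ m, k ≤ m → Y.map (LinearMap.lsmul C X (r ^ k)) =
      Y.map (LinearMap.lsmul C X (r ^ m)) := hk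
    have hsum : Y.map (LinearMap.lsmul C X (r ^ k)) ⊔
        (Y ⊓ LinearMap.ker (LinearMap.lsmul C X (r ^ k))) = Y := by
      refine le_antisymm (sup_le (hle _) inf_le_left) fun y hy => ?_
      have h1 : r ^ k • y ∈ Y.map (LinearMap.lsmul C X (r ^ (k + k))) := by
        rw [← hk _ (Nat.le_add_left _ _)]; exact ⟨y, hy, rfl⟩
      obtain ⟨z, hz, e⟩ := h1
      have : y = r ^ k • z + (y - r ^ k • z) := by abel
      rw [this]
      refine Submodule.add_mem_sup ⟨z, hz, rfl⟩ ⟨sub_mem hy (Y.smul_mem _ hz), ?_⟩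
      simp only [LinearMap.lsmul_apply, SetLike.mem_coe, LinearMap.mem_ker] at e ⊢
      rw [smul_sub, ← e, pow_add, mul_smul, sub_self]
    rcases hY.2 hsum with h | h
    · exfalso
      refine hr (le_antisymm (hle r) ?_)
      have h2 := (hk (k + 1) (Nat.le_succ k)).symm.trans h
      rw [pow_succ', hmul, h] at h2
      exact h2.ge
    · refine ⟨k, Module.mem_annihilator.2 fun y => ?_⟩
      have := h.ge y.2
      exact Subtype.ext this.2
  rw [hpmax] at hnil
  obtain ⟨k, hk⟩ := Ideal.exists_pow_le_of_le_radical_of_fg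
    (I := IsLocalRing.maximalIdeal C) (J := Module.annihilator C Y) (fun r hr => hnil r hr)
    (IsNoetherian.noetherian _)
  exact finite_of_isArtinian_of_pow_smul k hk

/-- For an Artinian module `X` over a Noetherian local ring, `X / r X` is finite for every `r`
outside of finitely many nonmaximal primes. -/
theorem exists_finset_prime_finite_quotient {C X : Type*} [CommRing C] [IsLocalRing C]
    [IsNoetherianRing C] [AddCommGroup X] [Module C X] [IsArtinian C X] :
    ∃ s : Finset (Ideal C), (∀ p ∈ s, p.IsPrime ∧ p ≠ IsLocalRing.maximalIdeal C) ∧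
      ∀ r : C, (∀ p ∈ s, r ∉ p) →
        Module.Finite C (X ⧸ LinearMap.range (LinearMap.lsmul C X r)) := by
  classical
  obtain ⟨S, hS, hirr⟩ := exists_supIrred_decomposition (⊤ : Submodule C X)
  choose! q hq using fun (Y : Submodule C X) (hY : Y ∈ S)
      (hf : ¬ Module.Finite C ↥Y) =>
    (hirr hY).finite_or_exists_prime.resolve_left hf
  refine ⟨(S.filter fun Y : Submodule C X => ¬ Module.Finite C ↥Y).image q, ?_, ?_⟩
  · intro p hp
    simp only [Finset.mem_image, Finset.mem_filter] at hp
    obtain ⟨Y, ⟨hYS, hYf⟩, rfl⟩ := hp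
    exact ⟨(hq Y hYS hYf).1, (hq Y hYS hYf).2.1⟩
  · intro r hr
    let Z : Submodule C X := (S.filter fun Y : Submodule C X => Module.Finite C ↥Y).sup id
    have hZ : Z.FG := by
      refine Submodule.fg_finset_sup _ _ fun Y hY => ?_
      exact Module.Finite.iff_fg.1 (Finset.mem_filter.1 hY).2
    have : Module.Finite C Z := Module.Finite.iff_fg.2 hZ
    have htop : (⊤ : Submodule C X) ≤ Z ⊔ LinearMap.range (LinearMap.lsmul C X r) := by
      rw [← hS]
      refine Finset.sup_le fun Y hY => ?_
      by_cases hf : Module.Finite C Y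
      · exact le_trans (Finset.le_sup (f := id) (Finset.mem_filter.2 ⟨hY, hf⟩)) le_sup_left
      · refine le_trans ((hq Y hY hf).2.2 r (hr _ ?_)) (le_trans ?_ le_sup_right)
        · exact Finset.mem_image_of_mem _ (Finset.mem_filter.2 ⟨hY, hf⟩)
        · exact LinearMap.map_le_range
    refine Module.Finite.of_surjective
      ((LinearMap.range (LinearMap.lsmul C X r)).mkQ.comp Z.subtype) ?_
    rw [← LinearMap.range_eq_top, LinearMap.range_comp, Submodule.range_subtype,
      Submodule.map_mkQ_eq_top, sup_comm]
    exact top_le_iff.1 htop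

section ExactPair

variable {R : Type} [CommRing R] {N₁ N₂ N₃ : Type} [AddCommGroup N₁] [Module R N₁]
    [AddCommGroup N₂] [Module R N₂] [AddCommGroup N₃] [Module R N₃]

/-- The short complex of modules defined by an exact pair of linear maps. -/
abbrev exactPairComplex (f : N₁ →ₗ[R] N₂) (g : N₂ →ₗ[R] N₃) (hfg : Function.Exact f g) :
    ShortComplex (ModuleCat.{0} R) :=
  ModuleCat.shortComplexOfCompEqZero f g hfg.linearMap_comp_eq_zero

variable {f : N₁ →ₗ[R] N₂} {g : N₂ →ₗ[R] N₃}

theorem exactPairComplex_shortExact (hf : Function.Injective f) (hfg : Function.Exact f g)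
    (hg : Function.Surjective g) : (exactPairComplex f g hfg).ShortExact :=
  ModuleCat.shortComplex_shortExact _ hfg hf hg

/-- The class in `Ext^1` of a short exact sequence of modules. -/
noncomputable def exactPairClass (hf : Function.Injective f) (hfg : Function.Exact f g)
    (hg : Function.Surjective g) : Abelian.Ext (ModuleCat.of R N₃) (ModuleCat.of R N₁) 1 :=
  (exactPairComplex_shortExact hf hfg hg).extClass

theorem mk₀_comp_exactPairClass (hf : Function.Injective f) (hfg : Function.Exact f g)
    (hg : Function.Surjective g) :
    (Abelian.Ext.mk₀ (ModuleCat.ofHom g)).comp (exactPairClass hf hfg hg) (zero_add 1) = 0 :=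
  (exactPairComplex_shortExact hf hfg hg).comp_extClass

theorem exactPairClass_comp_mk₀ (hf : Function.Injective f) (hfg : Function.Exact f g)
    (hg : Function.Surjective g) :
    (exactPairClass hf hfg hg).comp (Abelian.Ext.mk₀ (ModuleCat.ofHom f)) (add_zero 1) = 0 :=
  (exactPairComplex_shortExact hf hfg hg).extClass_comp

variable {X : ModuleCat.{0} R} {n : ℕ}

theorem exists_comp_mk₀_eq (hf : Function.Injective f) (hfg : Function.Exact f g)
    (hg : Function.Surjective g) (x : Abelian.Ext X (ModuleCat.of R N₂) n)
    (hx : x.comp (Abelian.Ext.mk₀ (ModuleCat.ofHom g)) (add_zero n) = 0) :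
    ∃ y : Abelian.Ext X (ModuleCat.of R N₁) n,
      y.comp (Abelian.Ext.mk₀ (ModuleCat.ofHom f)) (add_zero n) = x :=
  Abelian.Ext.covariant_sequence_exact₂ _ (exactPairComplex_shortExact hf hfg hg) x hx

theorem exists_comp_mk₀_eq_of_comp_class (hf : Function.Injective f) (hfg : Function.Exact f g)
    (hg : Function.Surjective g) (x : Abelian.Ext X (ModuleCat.of R N₃) n)
    (hx : x.comp (exactPairClass hf hfg hg) rfl = 0) :
    ∃ y : Abelian.Ext X (ModuleCat.of R N₂) n,
      y.comp (Abelian.Ext.mk₀ (ModuleCat.ofHom g)) (add_zero n) = x :=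
  Abelian.Ext.covariant_sequence_exact₃ _ (exactPairComplex_shortExact hf hfg hg) x rfl hx

theorem exists_comp_class_eq (hf : Function.Injective f) (hfg : Function.Exact f g)
    (hg : Function.Surjective g) (x : Abelian.Ext X (ModuleCat.of R N₁) (n + 1))
    (hx : x.comp (Abelian.Ext.mk₀ (ModuleCat.ofHom f)) (add_zero (n + 1)) = 0) :
    ∃ y : Abelian.Ext X (ModuleCat.of R N₃) n, y.comp (exactPairClass hf hfg hg) rfl = x :=
  Abelian.Ext.covariant_sequence_exact₁ _ (exactPairComplex_shortExact hf hfg hg) x hx rfl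

theorem exactPairClass_naturality {N₁' N₂' N₃' : Type} [AddCommGroup N₁'] [Module R N₁']
    [AddCommGroup N₂'] [Module R N₂'] [AddCommGroup N₃'] [Module R N₃']
    {f' : N₁' →ₗ[R] N₂'} {g' : N₂' →ₗ[R] N₃'} (hf : Function.Injective f)
    (hfg : Function.Exact f g) (hg : Function.Surjective g) (hf' : Function.Injective f')
    (hfg' : Function.Exact f' g') (hg' : Function.Surjective g') (α : N₁ →ₗ[R] N₁')
    (β : N₂ →ₗ[R] N₂') (γ : N₃ →ₗ[R] N₃') (h₁ : f' ∘ₗ α = β ∘ₗ f) (h₂ : g' ∘ₗ β = γ ∘ₗ g) :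
    (exactPairClass hf hfg hg).comp (Abelian.Ext.mk₀ (ModuleCat.ofHom α)) (add_zero 1) =
      (Abelian.Ext.mk₀ (ModuleCat.ofHom γ)).comp (exactPairClass hf' hfg' hg') (zero_add 1) :=
  ShortComplex.ShortExact.extClass_naturality (exactPairComplex_shortExact hf hfg hg)
    (exactPairComplex_shortExact hf' hfg' hg')
    { τ₁ := ModuleCat.ofHom α
      τ₂ := ModuleCat.ofHom β
      τ₃ := ModuleCat.ofHom γ
      comm₁₂ := by ext x; exact LinearMap.congr_fun h₁ x
      comm₂₃ := by ext x; exact LinearMap.congr_fun h₂ x }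

end ExactPair

section LimExt

variable {R : Type} [CommRing R] (a : Ideal R) (i : ℕ) (N : Type) [AddCommGroup N] [Module R N]

/-- The module `R / a ^ t` as an object of the category of `R`-modules. -/
abbrev powQuot (t : ℕ) : ModuleCat.{0} R := ModuleCat.of R (R ⧸ a ^ t)

/-- The projection `R / a ^ s ⟶ R / a ^ t` for `t ≤ s`. -/
def powQuotMap {t s : ℕ} (h : t ≤ s) : powQuot a s ⟶ powQuot a t :=
  ModuleCat.ofHom (Submodule.mapQ _ _ LinearMap.id (Ideal.pow_le_pow_right h))

/-- The group `Ext^i(R / a ^ t, N)`. -/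
abbrev PowExt (t : ℕ) : Type := Abelian.Ext (powQuot a t) (ModuleCat.of R N) i

/-- The transition maps between the groups `Ext^i(R / a ^ t, N)`. -/
noncomputable def powExtMap (t s : ℕ) (h : t ≤ s) : PowExt a i N t →+ PowExt a i N s :=
  (Abelian.Ext.mk₀ (powQuotMap a h)).precomp (ModuleCat.of R N) (zero_add i)

theorem powExtMap_apply {t s : ℕ} (h : t ≤ s) (e : PowExt a i N t) :
    powExtMap a i N t s h e = (Abelian.Ext.mk₀ (powQuotMap a h)).comp e (zero_add i) := rfl

theorem powQuotMap_refl (t : ℕ) : powQuotMap a (le_refl t) = 𝟙 _ := by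
  ext
  rfl

theorem powQuotMap_comp {t s u : ℕ} (h : t ≤ s) (h' : s ≤ u) :
    powQuotMap a h' ≫ powQuotMap a h = powQuotMap a (h.trans h') := by
  ext
  rfl

instance powExt_directedSystem : DirectedSystem (PowExt a i N) (powExtMap a i N · · ·) where
  map_self t x := by
    rw [powExtMap_apply, powQuotMap_refl, Abelian.Ext.mk₀_id_comp]
  map_map t s u h h' x := by
    rw [powExtMap_apply, powExtMap_apply, powExtMap_apply, Abelian.Ext.mk₀_comp_mk₀_assoc,
      powQuotMap_comp]

/-- The direct limit of the groups `Ext^i(R / a ^ t, N)`. -/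
def LimExt : Type := AddCommGroup.DirectLimit (PowExt a i N) (powExtMap a i N)

namespace LimExt

noncomputable instance : AddCommGroup (LimExt a i N) :=
  inferInstanceAs (AddCommGroup (AddCommGroup.DirectLimit (PowExt a i N) (powExtMap a i N)))

/-- The structure maps of the direct limit. -/
noncomputable def of (t : ℕ) : PowExt a i N t →+ LimExt a i N :=
  AddCommGroup.DirectLimit.of (PowExt a i N) (powExtMap a i N) t

variable {a i N}

theorem of_comp {t s : ℕ} (h : t ≤ s) (e : PowExt a i N t) :
    of a i N s ((Abelian.Ext.mk₀ (powQuotMap a h)).comp e (zero_add i)) = of a i N t e :=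
  AddCommGroup.DirectLimit.of_f (f := powExtMap a i N) h e

theorem exists_of (x : LimExt a i N) : ∃ t e, of a i N t e = x :=
  AddCommGroup.DirectLimit.induction_on (C := fun x => ∃ t e, of a i N t e = x) x
    fun t e => ⟨t, e, rfl⟩

theorem of_eq_zero {t : ℕ} {e : PowExt a i N t} (h : of a i N t e = 0) :
    ∃ s, ∃ hs : t ≤ s, (Abelian.Ext.mk₀ (powQuotMap a hs)).comp e (zero_add i) = 0 :=
  AddCommGroup.DirectLimit.of.zero_exact (f := powExtMap a i N) t e h

section map

variable {N' : Type} [AddCommGroup N'] [Module R N'] {N'' : Type} [AddCommGroup N''] [Module R N'']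

variable (a i) in
/-- Functoriality of the direct limit of the `Ext^i(R / a ^ t, N)` in `N`. -/
noncomputable def map (f : N →ₗ[R] N') : LimExt a i N →+ LimExt a i N' :=
  AddCommGroup.DirectLimit.map
    (fun t => (Abelian.Ext.mk₀ (ModuleCat.ofHom f)).postcomp (powQuot a t) (add_zero i))
    (fun t s h => by
      ext e
      exact Abelian.Ext.comp_assoc_of_third_deg_zero _ e _ (zero_add i))

theorem map_of (f : N →ₗ[R] N') {t : ℕ} (e : PowExt a i N t) :
    map a i f (of a i N t e) =
      of a i N' t (e.comp (Abelian.Ext.mk₀ (ModuleCat.ofHom f)) (add_zero i)) :=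
  AddCommGroup.DirectLimit.map_apply_of _ _ _

theorem map_id (x : LimExt a i N) : map a i LinearMap.id x = x := by
  obtain ⟨t, e, rfl⟩ := exists_of x
  rw [map_of, ModuleCat.ofHom_id, Abelian.Ext.comp_mk₀_id]

theorem map_map (f : N →ₗ[R] N') (g : N' →ₗ[R] N'') (x : LimExt a i N) :
    map a i g (map a i f x) = map a i (g ∘ₗ f) x := by
  obtain ⟨t, e, rfl⟩ := exists_of x
  rw [map_of, map_of, map_of, Abelian.Ext.comp_assoc_of_third_deg_zero, Abelian.Ext.mk₀_comp_mk₀,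
    ModuleCat.ofHom_comp]

theorem map_add' (f g : N →ₗ[R] N') (x : LimExt a i N) :
    map a i (f + g) x = map a i f x + map a i g x := by
  obtain ⟨t, e, rfl⟩ := exists_of x
  rw [map_of, map_of, map_of, ModuleCat.ofHom_add, Abelian.Ext.mk₀_add, Abelian.Ext.comp_add,
    _root_.map_add]

theorem map_zero' (x : LimExt a i N) : map a i (0 : N →ₗ[R] N') x = 0 := by
  have := map_add' (0 : N →ₗ[R] N') 0 x
  simpa using this

end map

section exact

variable {N₁ N₂ N₃ : Type} [AddCommGroup N₁] [Module R N₁]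
    [AddCommGroup N₂] [Module R N₂] [AddCommGroup N₃] [Module R N₃]
    {f : N₁ →ₗ[R] N₂} {g : N₂ →ₗ[R] N₃}

variable (a i) in
/-- The connecting homomorphism. -/
noncomputable def delta (hf : Function.Injective f) (hfg : Function.Exact f g)
    (hg : Function.Surjective g) : LimExt a i N₃ →+ LimExt a (i + 1) N₁ :=
  AddCommGroup.DirectLimit.map
    (fun t => (exactPairClass hf hfg hg).postcomp (powQuot a t) rfl)
    (fun t s h => by
      ext e
      exact Abelian.Ext.comp_assoc _ e _ (zero_add i) rfl (by lia))

theorem delta_of (hf : Function.Injective f) (hfg : Function.Exact f g)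
    (hg : Function.Surjective g) {t : ℕ} (e : PowExt a i N₃ t) :
    delta a i hf hfg hg (of a i N₃ t e) =
      of a (i + 1) N₁ t (e.comp (exactPairClass hf hfg hg) rfl) :=
  AddCommGroup.DirectLimit.map_apply_of _ _ _

theorem exact_map_map (hf : Function.Injective f) (hfg : Function.Exact f g)
    (hg : Function.Surjective g) : Function.Exact (map a i f) (map a i g) := by
  intro x
  constructor
  · intro hx
    obtain ⟨t, e, rfl⟩ := exists_of x
    rw [map_of] at hx
    obtain ⟨s, hs, h⟩ := of_eq_zero hx
    rw [← Abelian.Ext.comp_assoc_of_third_deg_zero] at h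
    obtain ⟨e', he'⟩ := exists_comp_mk₀_eq hf hfg hg _ h
    refine ⟨of a i N₁ s e', ?_⟩
    rw [map_of, ← of_comp hs, he']
  · rintro ⟨y, rfl⟩
    rw [map_map, hfg.linearMap_comp_eq_zero, map_zero']

theorem exact_map_delta (hf : Function.Injective f) (hfg : Function.Exact f g)
    (hg : Function.Surjective g) : Function.Exact (map a i g) (delta a i hf hfg hg) := by
  intro x
  constructor
  · intro hx
    obtain ⟨t, e, rfl⟩ := exists_of x
    rw [delta_of] at hx
    obtain ⟨s, hs, h⟩ := of_eq_zero hx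
    rw [← Abelian.Ext.comp_assoc _ _ _ (zero_add i) rfl (by lia)] at h
    obtain ⟨e', he'⟩ := exists_comp_mk₀_eq_of_comp_class hf hfg hg _ h
    refine ⟨of a i N₂ s e', ?_⟩
    rw [map_of, ← of_comp hs, he']
  · rintro ⟨y, rfl⟩
    obtain ⟨t, e, rfl⟩ := exists_of y
    rw [map_of, delta_of]
    rw [Abelian.Ext.comp_assoc _ _ _ (add_zero i) (zero_add 1) (by lia), mk₀_comp_exactPairClass,
      Abelian.Ext.comp_zero, map_zero]

theorem exact_delta_map (hf : Function.Injective f) (hfg : Function.Exact f g)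
    (hg : Function.Surjective g) :
    Function.Exact (delta a i hf hfg hg) (map a (i + 1) f) := by
  intro x
  constructor
  · intro hx
    obtain ⟨t, e, rfl⟩ := exists_of x
    rw [map_of] at hx
    obtain ⟨s, hs, h⟩ := of_eq_zero hx
    rw [← Abelian.Ext.comp_assoc_of_third_deg_zero] at h
    obtain ⟨e', he'⟩ := exists_comp_class_eq hf hfg hg _ h
    refine ⟨of a i N₃ s e', ?_⟩
    rw [delta_of, ← of_comp hs, he']
  · rintro ⟨y, rfl⟩
    obtain ⟨t, e, rfl⟩ := exists_of y
    rw [delta_of, map_of]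
    rw [Abelian.Ext.comp_assoc _ _ _ rfl (add_zero 1) (by lia), exactPairClass_comp_mk₀,
      Abelian.Ext.comp_zero, map_zero]

theorem map_injective_zero (hf : Function.Injective f) : Function.Injective (map a 0 f) := by
  rw [injective_iff_map_eq_zero]
  intro x hx
  obtain ⟨t, e, rfl⟩ := exists_of x
  rw [map_of] at hx
  obtain ⟨s, hs, h⟩ := of_eq_zero hx
  rw [← Abelian.Ext.comp_assoc_of_third_deg_zero] at h
  have : Mono (ModuleCat.ofHom f) := (ModuleCat.mono_iff_injective _).2 hf
  rw [← of_comp hs]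
  have h0 := Abelian.Ext.postcomp_mk₀_injective_of_mono (powQuot a s) (ModuleCat.ofHom f)
    (a₁ := (Abelian.Ext.mk₀ (powQuotMap a hs)).comp e (zero_add 0)) (a₂ := 0)
    (h.trans (map_zero _).symm)
  rw [h0, map_zero]

theorem delta_naturality {N₁' N₂' N₃' : Type} [AddCommGroup N₁'] [Module R N₁']
    [AddCommGroup N₂'] [Module R N₂'] [AddCommGroup N₃'] [Module R N₃']
    {f' : N₁' →ₗ[R] N₂'} {g' : N₂' →ₗ[R] N₃'} (hf : Function.Injective f)
    (hfg : Function.Exact f g) (hg : Function.Surjective g) (hf' : Function.Injective f')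
    (hfg' : Function.Exact f' g') (hg' : Function.Surjective g') (α : N₁ →ₗ[R] N₁')
    (β : N₂ →ₗ[R] N₂') (γ : N₃ →ₗ[R] N₃') (h₁ : f' ∘ₗ α = β ∘ₗ f) (h₂ : g' ∘ₗ β = γ ∘ₗ g)
    (x : LimExt a i N₃) :
    map a (i + 1) α (delta a i hf hfg hg x) = delta a i hf' hfg' hg' (map a i γ x) := by
  obtain ⟨t, e, rfl⟩ := exists_of x
  rw [delta_of, map_of, map_of, delta_of]
  rw [Abelian.Ext.comp_assoc _ _ _ rfl (add_zero 1) (by lia),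
    Abelian.Ext.comp_assoc _ _ _ (add_zero i) (zero_add 1) (by lia),
    exactPairClass_naturality hf hfg hg hf' hfg' hg' α β γ h₁ h₂]

end exact

end LimExt

end LimExt

namespace LimExt

section smul

variable {R : Type} [CommRing R] {a : Ideal R} {i : ℕ} {S : Type} [CommRing S] [Algebra R S]
    {N : Type} [AddCommGroup N] [Module R N] [Module S N] [IsScalarTower R S N]

variable (R) in
/-- Multiplication by `s : S` on an `S`-module, as an `R`-linear map. -/
def smulMap (N : Type) [AddCommGroup N] [Module R N] [Module S N] [IsScalarTower R S N] (s : S) :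
    N →ₗ[R] N := (LinearMap.lsmul S N s).restrictScalars R

@[simp]
theorem smulMap_apply (s : S) (x : N) : smulMap R N s x = s • x := rfl

theorem smulMap_one : smulMap R N (1 : S) = LinearMap.id :=
  LinearMap.ext fun x => one_smul S x

theorem smulMap_zero : smulMap R N (0 : S) = 0 :=
  LinearMap.ext fun x => zero_smul S x

theorem smulMap_add (s t : S) : smulMap R N (s + t) = smulMap R N s + smulMap R N t :=
  LinearMap.ext fun x => add_smul s t x

theorem smulMap_mul (s t : S) : smulMap R N (s * t) = smulMap R N s ∘ₗ smulMap R N t :=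
  LinearMap.ext fun x => mul_smul s t x

noncomputable instance : SMul S (LimExt a i N) where
  smul s x := map a i (smulMap R N s) x

theorem smul_eq_map (s : S) (x : LimExt a i N) : s • x = map a i (smulMap R N s) x := rfl

noncomputable instance : Module S (LimExt a i N) where
  one_smul x := by rw [smul_eq_map, smulMap_one, map_id]
  mul_smul s t x := by rw [smul_eq_map, smul_eq_map, smul_eq_map, map_map, smulMap_mul]
  smul_zero s := map_zero _
  smul_add s := map_add _
  add_smul s t x := by rw [smul_eq_map, smul_eq_map, smul_eq_map, smulMap_add, map_add']
  zero_smul x := by rw [smul_eq_map, smulMap_zero, map_zero']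

theorem smul_of (s : S) {t : ℕ} (e : PowExt a i N t) : s • of a i N t e =
    of a i N t (e.comp (Abelian.Ext.mk₀ (ModuleCat.ofHom (smulMap R N s))) (add_zero i)) :=
  map_of _ _

theorem smul_of' (r : R) {t : ℕ} (e : PowExt a i N t) : r • of a i N t e = of a i N t (r • e) := by
  rw [smul_of, Abelian.Ext.smul_eq_comp_mk₀]
  rfl

instance {S' : Type} [CommRing S'] [Algebra R S'] [Module S' N] [IsScalarTower R S' N]
    [Algebra S S'] [IsScalarTower S S' N] : IsScalarTower S S' (LimExt a i N) where
  smul_assoc s s' x := by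
    rw [smul_eq_map, smul_eq_map, smul_eq_map, map_map]
    exact congrArg (fun f => map a i f x) (LinearMap.ext fun y => smul_assoc s s' y)

variable {N' : Type} [AddCommGroup N'] [Module R N'] [Module S N'] [IsScalarTower R S N']

theorem map_smul_of_comm (f : N →ₗ[R] N') (s : S) (hf : ∀ x, f (s • x) = s • f x)
    (x : LimExt a i N) : map a i f (s • x) = s • map a i f x := by
  rw [smul_eq_map, smul_eq_map, map_map, map_map]
  exact congrArg (fun f => map a i f x) (LinearMap.ext hf)

variable (a i) in
/-- Functoriality of `LimExt` for `S`-linear maps. -/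
noncomputable def mapₗ (f : N →ₗ[S] N') : LimExt a i N →ₗ[S] LimExt a i N' where
  toFun := map a i (f.restrictScalars R)
  map_add' := _root_.map_add _
  map_smul' s x := map_smul_of_comm _ s (by simp) x

theorem mapₗ_apply (f : N →ₗ[S] N') (x : LimExt a i N) :
    mapₗ a i f x = map a i (f.restrictScalars R) x := rfl

variable {N₁ N₂ N₃ : Type} [AddCommGroup N₁] [AddCommGroup N₂] [AddCommGroup N₃]
    [Module R N₁] [Module R N₂] [Module R N₃] [Module S N₁] [Module S N₂] [Module S N₃]
    [IsScalarTower R S N₁] [IsScalarTower R S N₂] [IsScalarTower R S N₃]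
    {f : N₁ →ₗ[S] N₂} {g : N₂ →ₗ[S] N₃}

theorem exact_mapₗ (hf : Function.Injective f) (hfg : Function.Exact f g)
    (hg : Function.Surjective g) : Function.Exact (mapₗ a i f) (mapₗ a i g) :=
  exact_map_map (f := f.restrictScalars R) (g := g.restrictScalars R) hf hfg hg

variable (a i) in
/-- The connecting homomorphism as an `S`-linear map. -/
noncomputable def deltaₗ (hf : Function.Injective f) (hfg : Function.Exact f g)
    (hg : Function.Surjective g) : LimExt a i N₃ →ₗ[S] LimExt a (i + 1) N₁ where
  toFun := delta a i (f := f.restrictScalars R) (g := g.restrictScalars R) hf hfg hg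
  map_add' := _root_.map_add _
  map_smul' s x := by
    simp only [smul_eq_map]
    refine (delta_naturality _ _ _ _ _ _ _ (smulMap R N₂ s) _ ?_ ?_ _).symm <;> ext x <;> simp

theorem exact_mapₗ_deltaₗ (hf : Function.Injective f) (hfg : Function.Exact f g)
    (hg : Function.Surjective g) : Function.Exact (mapₗ a i g) (deltaₗ a i hf hfg hg) :=
  exact_map_delta (f := f.restrictScalars R) (g := g.restrictScalars R) hf hfg hg

theorem exact_deltaₗ_mapₗ (hf : Function.Injective f) (hfg : Function.Exact f g)
    (hg : Function.Surjective g) :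
    Function.Exact (deltaₗ a i hf hfg hg) (mapₗ a (i + 1) f) :=
  exact_delta_map (f := f.restrictScalars R) (g := g.restrictScalars R) hf hfg hg

theorem mapₗ_injective_zero (hf : Function.Injective f) : Function.Injective (mapₗ a 0 f) :=
  map_injective_zero (f := f.restrictScalars R) hf

end smul

section torsion

variable {R : Type} [CommRing R] {a : Ideal R} {i : ℕ} {N : Type} [AddCommGroup N] [Module R N]

theorem exists_pow_smul_eq_zero (x : LimExt a i N) : ∃ t : ℕ, ∀ r ∈ a ^ t, r • x = 0 := by
  obtain ⟨t, e, rfl⟩ := exists_of x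
  refine ⟨t, fun r hr => ?_⟩
  rw [smul_of']
  have h : r • (Abelian.Ext.mk₀ (𝟙 (powQuot a t))) = 0 := by
    rw [← Abelian.Ext.mk₀_smul]
    have : r • 𝟙 (powQuot a t) = 0 := by
      ext
      change r • (Ideal.Quotient.mk (a ^ t) 1) = 0
      rw [← Ideal.Quotient.mk_eq_mk, ← Submodule.Quotient.mk_smul, Submodule.Quotient.mk_eq_zero]
      simpa using hr
    rw [this, Abelian.Ext.mk₀_zero]
  have h2 : r • e = 0 := by
    conv_lhs => rw [← Abelian.Ext.mk₀_id_comp e]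
    rw [← Abelian.Ext.smul_comp, h, Abelian.Ext.zero_comp]
  rw [h2, _root_.map_zero]

theorem exists_pow_smul_eq_zero' {S : Type} [CommRing S] [Algebra R S] [Module S N]
    [IsScalarTower R S N] {r : R} (hr : r ∈ a) (x : LimExt a i N) :
    ∃ t : ℕ, (algebraMap R S r) ^ t • x = 0 := by
  obtain ⟨t, ht⟩ := exists_pow_smul_eq_zero x
  refine ⟨t, ?_⟩
  rw [← map_pow, algebraMap_smul]
  exact ht _ (Ideal.pow_mem_pow hr t)

end torsion

section zero

variable {R : Type} [CommRing R] (a : Ideal R)  {S : Type} [CommRing S] [Algebra R S]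
    {N : Type} [AddCommGroup N] [Module R N] [Module S N] [IsScalarTower R S N]

/-- The map `R / a ^ k → N` with `1 ↦ n` for a module `N` killed by `a ^ k`. -/
def quotSpan {k : ℕ} (hk : a ^ k ≤ Module.annihilator R N) (n : N) : R ⧸ a ^ k →ₗ[R] N :=
  Submodule.liftQ _ (LinearMap.toSpanSingleton R N n) fun r hr => by
    simpa using Module.mem_annihilator.1 (hk hr) n

theorem quotSpan_mk {k : ℕ} (hk : a ^ k ≤ Module.annihilator R N) (n : N) (r : R) :
    quotSpan a hk n (Submodule.Quotient.mk r) = r • n := by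
  rfl

/-- A module killed by a power of `a` maps to its zeroth local cohomology. -/
noncomputable def zeroOf {k : ℕ} (hk : a ^ k ≤ Module.annihilator R N) : N →ₗ[S] LimExt a 0 N where
  toFun n := of a 0 N k (Abelian.Ext.mk₀ (ModuleCat.ofHom (quotSpan a hk n)))
  map_add' m n := by
    rw [← map_add, ← Abelian.Ext.mk₀_add, ← ModuleCat.ofHom_add]
    congr 3
    ext
    exact smul_add (1 : R) m n
  map_smul' s n := by
    rw [RingHom.id_apply, smul_of, Abelian.Ext.mk₀_comp_mk₀, ← ModuleCat.ofHom_comp]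
    congr 3
    ext
    exact smul_comm (1 : R) s n

theorem zeroOf_injective {k : ℕ} (hk : a ^ k ≤ Module.annihilator R N) :
    Function.Injective (zeroOf a hk : N →ₗ[S] LimExt a 0 N) := by
  rw [injective_iff_map_eq_zero]
  intro n hn
  obtain ⟨s, hs, h⟩ := of_eq_zero hn
  rw [Abelian.Ext.mk₀_comp_mk₀, Abelian.Ext.mk₀_eq_zero_iff] at h
  have := LinearMap.congr_fun (congrArg ModuleCat.Hom.hom h) (Submodule.Quotient.mk 1)
  have h2 : quotSpan a hk n (Submodule.Quotient.mk 1) = 0 := this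
  rwa [quotSpan_mk, one_smul] at h2

theorem zeroOf_surjective {k : ℕ} (hk : a ^ k ≤ Module.annihilator R N) :
    Function.Surjective (zeroOf a hk : N →ₗ[S] LimExt a 0 N) := by
  intro x
  obtain ⟨t, e, rfl⟩ := exists_of x
  obtain ⟨f, rfl⟩ := (Abelian.Ext.mk₀_bijective _ _).2 e
  refine ⟨f.hom (Submodule.Quotient.mk 1), ?_⟩
  change of a 0 N k _ = _
  rw [← of_comp (Nat.le_add_left k t), ← of_comp (Nat.le_add_right t k), Abelian.Ext.mk₀_comp_mk₀,
    Abelian.Ext.mk₀_comp_mk₀]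
  congr 2
  ext
  change quotSpan a hk _ (Submodule.Quotient.mk 1) = f.hom (Submodule.Quotient.mk 1)
  rw [quotSpan_mk, one_smul]

end zero

end LimExt

section FiniteExt

variable {R : Type} [CommRing R]

theorem exists_class_comp_eq {F X : Type} [AddCommGroup F] [Module R F] [AddCommGroup X]
    [Module R X] [Module.Projective R F] (p : F →ₗ[R] X) (hp : Function.Surjective p)
    {N : ModuleCat.{0} R} {n : ℕ} (e : Abelian.Ext (ModuleCat.of R X) N (n + 1)) :
    ∃ e' : Abelian.Ext (ModuleCat.of R (LinearMap.ker p)) N n,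
      (exactPairClass (LinearMap.ker p).injective_subtype (LinearMap.exact_subtype_ker_map p)
        hp).comp e' (Nat.add_comm 1 n) = e := by
  have : Projective (ModuleCat.of R F) := (IsProjective.iff_projective _).1 inferInstance
  exact Abelian.Ext.contravariant_sequence_exact₃
    (exactPairComplex_shortExact (LinearMap.ker p).injective_subtype
      (LinearMap.exact_subtype_ker_map p) hp) N e (Abelian.Ext.eq_zero_of_projective _)
      (Nat.add_comm 1 n)

theorem mk₀_comp_class_comp {P Z F X : Type} [AddCommGroup F] [Module R F] [AddCommGroup X]
    [Module R X] [AddCommGroup P] [Module R P] [AddCommGroup Z] [Module R Z]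
    (p : F →ₗ[R] X) (hp : Function.Surjective p) (g : P →ₗ[R] Z) (hg : Function.Surjective g)
    (f : Z →ₗ[R] X) (β : P →ₗ[R] F) (hβ : ∀ x, p (β x) = f (g x))
    (α : LinearMap.ker g →ₗ[R] LinearMap.ker p) (hα : ∀ x, (α x : F) = β x)
    {N : ModuleCat.{0} R} {n : ℕ} (e : Abelian.Ext (ModuleCat.of R (LinearMap.ker p)) N n) :
    (Abelian.Ext.mk₀ (ModuleCat.ofHom f)).comp ((exactPairClass
      (LinearMap.ker p).injective_subtype (LinearMap.exact_subtype_ker_map p) hp).comp e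
        (Nat.add_comm 1 n)) (zero_add (n + 1)) =
    (exactPairClass (LinearMap.ker g).injective_subtype (LinearMap.exact_subtype_ker_map g)
      hg).comp ((Abelian.Ext.mk₀ (ModuleCat.ofHom α)).comp e (zero_add n)) (Nat.add_comm 1 n) := by
  have hnat := exactPairClass_naturality (LinearMap.ker g).injective_subtype
    (LinearMap.exact_subtype_ker_map g) hg (LinearMap.ker p).injective_subtype
    (LinearMap.exact_subtype_ker_map p) hp α β f (LinearMap.ext hα) (LinearMap.ext hβ)
  rw [← Abelian.Ext.comp_assoc _ _ _ (zero_add 1) (Nat.add_comm 1 n) (by lia), ← hnat,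
    Abelian.Ext.comp_assoc _ _ _ (add_zero 1) (zero_add n) (by lia)]

/-- On a module killed by a power of `a`, every class in `Ext^i(X, -)` becomes zero after
restriction to submodules of `a ^ s • X` for `s` large. -/
theorem exists_pow_restrict_ext_eq_zero [IsNoetherianRing R] {a : Ideal R} {k : ℕ}
    {N : Type} [AddCommGroup N] [Module R N] (hk : a ^ k ≤ Module.annihilator R N) (n : ℕ)
    (X : Type) [AddCommGroup X] [Module R X] [Module.Finite R X] :
    ∃ s : ℕ, ∀ (Z : Type) [AddCommGroup Z] [Module R Z] (f : Z →ₗ[R] X),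
      LinearMap.range f ≤ a ^ s • (⊤ : Submodule R X) →
      ∀ e : Abelian.Ext (ModuleCat.of R X) (ModuleCat.of R N) n,
        (Abelian.Ext.mk₀ (ModuleCat.ofHom f)).comp e (zero_add n) = 0 := by
  induction n generalizing X with
  | zero =>
    refine ⟨k, fun Z _ _ f hf e => ?_⟩
    obtain ⟨g, rfl⟩ := (Abelian.Ext.mk₀_bijective _ _).2 e
    rw [Abelian.Ext.mk₀_comp_mk₀, Abelian.Ext.mk₀_eq_zero_iff]
    ext z
    change g.hom (f z) = 0
    have h1 : a ^ k • (⊤ : Submodule R X) ≤ LinearMap.ker g.hom := by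
      rw [Submodule.smul_le]
      intro r hr x _
      rw [LinearMap.mem_ker, map_smul]
      exact Module.mem_annihilator.1 (hk hr) _
    exact h1 (hf ⟨z, rfl⟩)
  | succ n ih =>
    obtain ⟨m, p, hp⟩ := Module.Finite.exists_fin' R X
    obtain ⟨s, hs⟩ := ih (LinearMap.ker p)
    obtain ⟨c, hc⟩ := Ideal.exists_pow_inf_eq_pow_smul a (LinearMap.ker p)
    refine ⟨s + c, fun Z _ _ f hf e => ?_⟩
    obtain ⟨e', rfl⟩ := exists_class_comp_eq p hp e
    let P : Submodule R (Z × (Fin m → R)) :=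
      LinearMap.eqLocus (f ∘ₗ LinearMap.fst R _ _) (p ∘ₗ LinearMap.snd R _ _) ⊓
        (a ^ (s + c) • (⊤ : Submodule R (Fin m → R))).comap (LinearMap.snd R _ _)
    let g : P →ₗ[R] Z := LinearMap.fst R _ _ ∘ₗ P.subtype
    have hg : Function.Surjective g := by
      intro z
      have h1 : f z ∈ a ^ (s + c) • (⊤ : Submodule R X) := hf ⟨z, rfl⟩
      rw [← LinearMap.range_eq_top.2 hp, ← Submodule.map_top, ← Submodule.map_smul''] at h1
      obtain ⟨y, hy, hyz⟩ := h1
      exact ⟨⟨(z, y), hyz.symm, hy⟩, rfl⟩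
    let β : P →ₗ[R] (Fin m → R) := LinearMap.snd R _ _ ∘ₗ P.subtype
    have hβ : ∀ x, p (β x) = f (g x) := fun x => x.2.1.symm
    let α : LinearMap.ker g →ₗ[R] LinearMap.ker p :=
      LinearMap.restrict β fun x hx => by
        rw [LinearMap.mem_ker, hβ, LinearMap.mem_ker.1 hx, map_zero]
    have hα : LinearMap.range α ≤ a ^ s • (⊤ : Submodule R (LinearMap.ker p)) := by
      rintro _ ⟨x, rfl⟩
      have h2 : (α x : Fin m → R) ∈ a ^ (s + c) • ⊤ ⊓ LinearMap.ker p := ⟨x.1.2.2, (α x).2⟩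
      rw [hc _ (Nat.le_add_left c s), Nat.add_sub_cancel] at h2
      have h3 := Submodule.smul_mono (le_refl (a ^ s)) (inf_le_right : _ ≤ LinearMap.ker p) h2
      have h4 : a ^ s • LinearMap.ker p =
          (a ^ s • (⊤ : Submodule R (LinearMap.ker p))).map (LinearMap.ker p).subtype := by
        rw [Submodule.map_smul'', Submodule.map_top, Submodule.range_subtype]
      rw [h4] at h3
      obtain ⟨y, hy, hyx⟩ := h3
      rwa [Subtype.ext hyx] at hy
    rw [mk₀_comp_class_comp p hp g hg f β hβ α fun x => rfl]
    have h0 := hs (LinearMap.ker g) α hα e'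
    rw [h0, Abelian.Ext.comp_zero]

/-- Classes in `Ext^n(X, N)` with `X` finite come from finitely generated submodules of `N`. -/
theorem exists_fg_ext_eq [IsNoetherianRing R] {N : Type} [AddCommGroup N] [Module R N] (n : ℕ)
    (X : Type) [AddCommGroup X] [Module R X] [Module.Finite R X]
    (e : Abelian.Ext (ModuleCat.of R X) (ModuleCat.of R N) n) :
    ∃ (N₀ : Submodule R N) (_ : N₀.FG)
      (e₀ : Abelian.Ext (ModuleCat.of R X) (ModuleCat.of R N₀) n),
      e₀.comp (Abelian.Ext.mk₀ (ModuleCat.ofHom N₀.subtype)) (add_zero n) = e := by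
  induction n generalizing X with
  | zero =>
    obtain ⟨g, rfl⟩ := (Abelian.Ext.mk₀_bijective _ _).2 e
    refine ⟨LinearMap.range g.hom, Module.Finite.iff_fg.1 inferInstance,
      Abelian.Ext.mk₀ (ModuleCat.ofHom g.hom.rangeRestrict), ?_⟩
    rw [Abelian.Ext.mk₀_comp_mk₀]
    congr 1
  | succ n ih =>
    obtain ⟨m, p, hp⟩ := Module.Finite.exists_fin' R X
    obtain ⟨e', rfl⟩ := exists_class_comp_eq p hp e
    obtain ⟨N₀, h, e₀, rfl⟩ := ih (LinearMap.ker p) e'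
    exact ⟨N₀, h, _, Abelian.Ext.comp_assoc _ _ _ (Nat.add_comm 1 n) (add_zero n) (by lia)⟩

end FiniteExt

namespace LimExt

variable {R : Type} [CommRing R] [IsNoetherianRing R] {a : Ideal R}

theorem subsingleton_of_pow_le_annihilator {k : ℕ} {N : Type} [AddCommGroup N] [Module R N]
    (hk : a ^ k ≤ Module.annihilator R N) (i : ℕ) : Subsingleton (LimExt a (i + 1) N) := by
  refine subsingleton_of_forall_eq 0 fun x => ?_
  obtain ⟨t, e, rfl⟩ := exists_of x
  obtain ⟨e', rfl⟩ := exists_class_comp_eq (a ^ t).mkQ (Submodule.mkQ_surjective _) e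
  obtain ⟨s, hs⟩ := exists_pow_restrict_ext_eq_zero hk i (LinearMap.ker (a ^ t).mkQ)
  let α : LinearMap.ker (a ^ (t + s)).mkQ →ₗ[R] LinearMap.ker (a ^ t).mkQ :=
    Submodule.inclusion (by
      rw [Submodule.ker_mkQ, Submodule.ker_mkQ]
      exact Ideal.pow_le_pow_right (Nat.le_add_right t s))
  have hα : LinearMap.range α ≤ a ^ s • (⊤ : Submodule R (LinearMap.ker (a ^ t).mkQ)) := by
    rintro _ ⟨x, rfl⟩
    have h4 : a ^ s • LinearMap.ker (a ^ t).mkQ =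
        (a ^ s • (⊤ : Submodule R (LinearMap.ker (a ^ t).mkQ))).map
          (LinearMap.ker (a ^ t).mkQ).subtype := by
      rw [Submodule.map_smul'', Submodule.map_top, Submodule.range_subtype]
    have h3 : (x : R) ∈ a ^ s • LinearMap.ker (a ^ t).mkQ := by
      have hx : (x : R) ∈ a ^ (t + s) := by simpa only [Submodule.ker_mkQ] using x.2
      rwa [Submodule.ker_mkQ, smul_eq_mul, ← pow_add, add_comm s t]
    rw [h4] at h3
    obtain ⟨y, hy, hyx⟩ := h3
    have : y = α x := Subtype.ext hyx
    rwa [this] at hy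
  rw [← of_comp (Nat.le_add_right t s),
    ← Abelian.Ext.comp_assoc _ _ _ (zero_add 1) (Nat.add_comm 1 i) (by lia)]
  have := exactPairClass_naturality (LinearMap.ker (a ^ (t + s)).mkQ).injective_subtype
    (LinearMap.exact_subtype_ker_map _) (Submodule.mkQ_surjective _)
    (LinearMap.ker (a ^ t).mkQ).injective_subtype
    (LinearMap.exact_subtype_ker_map _) (Submodule.mkQ_surjective _)
    α LinearMap.id (Submodule.mapQ _ _ LinearMap.id
      (Ideal.pow_le_pow_right (Nat.le_add_right t s))) (by ext; rfl) (by ext; rfl)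
  rw [powQuotMap, ← this, Abelian.Ext.comp_assoc _ _ _ (add_zero 1) (zero_add i) (by lia),
    hs _ α hα, Abelian.Ext.comp_zero, map_zero]

theorem exists_fg_map_eq {i : ℕ} {N : Type} [AddCommGroup N] [Module R N] (x : LimExt a i N) :
    ∃ (N₀ : Submodule R N) (_ : N₀.FG) (y : LimExt a i N₀), map a i N₀.subtype y = x := by
  obtain ⟨t, e, rfl⟩ := exists_of x
  obtain ⟨N₀, h, e₀, rfl⟩ := exists_fg_ext_eq i (R ⧸ a ^ t) e
  exact ⟨N₀, h, of a i N₀ t e₀, map_of _ _⟩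

end LimExt

section

open scoped Pointwise

section torsionReduction

variable {R : Type} [CommRing R] (a : Ideal R) {S : Type} [CommRing S] [Algebra R S]
    [IsNoetherianRing S] (N : Type) [AddCommGroup N] [Module S N] [Module.Finite S N]

theorem exists_torsion_submodule_regular_quotient :
    ∃ (Γ : Submodule S N) (k : ℕ) (r : R),
      (a.map (algebraMap R S)) ^ k ≤ Module.annihilator S Γ ∧ r ∈ a ∧
      IsSMulRegular (N ⧸ Γ) (algebraMap R S r) := by
  set J := a.map (algebraMap R S) with hJ
  obtain ⟨k, hk⟩ := monotone_stabilizes_iff_noetherian.2 (inferInstance : IsNoetherian S N)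
    ⟨fun k => Submodule.torsionBySet S N ↑(J ^ k),
      fun i j h => Submodule.torsionBySet_le_torsionBySet_pow i j h J⟩
  refine ⟨Submodule.torsionBySet S N ↑(J ^ k), k, ?_⟩
  set Γ := Submodule.torsionBySet S N ↑(J ^ k) with hΓ
  have key : ∀ y : N ⧸ Γ, (∀ r ∈ J, r • y = 0) → y = 0 := by
    intro y hy
    obtain ⟨x, rfl⟩ := Submodule.Quotient.mk_surjective _ y
    rw [Submodule.Quotient.mk_eq_zero]
    have h1 : Γ = Submodule.torsionBySet S N ↑(J ^ (k + 1)) := hk (k + 1) (Nat.le_succ k)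
    rw [h1, Submodule.mem_torsionBySet_iff]
    suffices ∀ s ∈ J ^ k * J, s • x = 0 from fun s => this s (pow_succ J k ▸ s.2)
    intro s hs
    induction hs using Submodule.mul_induction_on' with
    | mem_mul_mem u hu v hv =>
      have := hy v hv
      rw [← Submodule.Quotient.mk_smul, Submodule.Quotient.mk_eq_zero,
        Submodule.mem_torsionBySet_iff] at this
      rw [mul_smul]
      exact this ⟨u, hu⟩
    | add u _ v _ hu hv => rw [add_smul, hu, hv, add_zero]
  have : ∃ r ∈ a, IsSMulRegular (N ⧸ Γ) (algebraMap R S r) := by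
    by_contra! hcon
    have h1 : (a : Set R) ⊆ ⋃ p ∈ associatedPrimes S (N ⧸ Γ), (p.comap (algebraMap R S)) := by
      intro r hr
      have h2 : algebraMap R S r ∈ ⋃ p ∈ associatedPrimes S (N ⧸ Γ), (p : Set S) := by
        rw [biUnion_associatedPrimes_eq_compl_regular]
        exact hcon r hr
      simpa using h2
    obtain ⟨p, hp, hap⟩ := (Ideal.subset_union_prime_finite
      (associatedPrimes.finite S (N ⧸ Γ)) (f := fun p => p.comap (algebraMap R S)) 0 0
      fun p hp _ _ => haveI := IsAssociatedPrime.isPrime hp; inferInstance).1 h1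
    have hJp : J ≤ p := Ideal.map_le_iff_le_comap.2 hap
    rw [AssociatedPrimes.mem_iff, isAssociatedPrime_iff] at hp
    obtain ⟨hp, x, rfl⟩ := hp
    have hx : x = 0 := key x fun r hr => by
      have := hJp hr
      simpa [Submodule.mem_colon_singleton] using this
    apply hp.ne_top
    rw [hx]
    simp
  obtain ⟨r, hr, hreg⟩ := this
  refine ⟨r, fun s hs => ?_, hr, hreg⟩
  rw [Module.mem_annihilator]
  rintro ⟨x, hx⟩
  rw [hΓ, Submodule.mem_torsionBySet_iff] at hx
  exact Subtype.ext (hx ⟨s, hs⟩)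

end torsionReduction

theorem pow_le_annihilator_of_map {R : Type} [CommRing R] {a : Ideal R} {S : Type} [CommRing S]
    [Algebra R S] {N : Type} [AddCommGroup N] [Module R N] [Module S N] [IsScalarTower R S N] {k : ℕ}
    (h : (a.map (algebraMap R S)) ^ k ≤ Module.annihilator S N) :
    a ^ k ≤ Module.annihilator R N := by
  intro r hr
  rw [Module.mem_annihilator]
  intro x
  rw [← algebraMap_smul S]
  refine Module.mem_annihilator.1 (h ?_) x
  rw [← Ideal.map_pow]
  exact Ideal.mem_map_of_mem _ hr

namespace LimExt

variable {R : Type} [CommRing R] {a : Ideal R} {S : Type} [CommRing S] [Algebra R S]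
    {N : Type} [AddCommGroup N] [Module R N] [Module S N] [IsScalarTower R S N]

theorem subsingleton_of_subsingleton [Subsingleton N] (i : ℕ) : Subsingleton (LimExt a i N) :=
  subsingleton_of_forall_eq 0 fun x => by
    rw [← map_id x, Subsingleton.elim (LinearMap.id : N →ₗ[R] N) 0, map_zero']

theorem exact_lsmul_mkQ (s : S) :
    Function.Exact (LinearMap.lsmul S N s) (s • (⊤ : Submodule S N)).mkQ := by
  rw [LinearMap.exact_iff, Submodule.ker_mkQ]
  ext x
  simp [Submodule.mem_smul_pointwise_iff_exists]

theorem bijective_mapₗ_mkQ [IsNoetherianRing R] {Γ : Submodule S N} {k : ℕ}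
    (hΓ : a ^ k ≤ Module.annihilator R Γ) (i : ℕ) :
    Function.Bijective (mapₗ a (i + 1) Γ.mkQ) := by
  have h1 := subsingleton_of_pow_le_annihilator hΓ i
  have h2 := subsingleton_of_pow_le_annihilator hΓ (i + 1)
  constructor
  · rw [injective_iff_map_eq_zero]
    intro x hx
    obtain ⟨y, rfl⟩ := (exact_mapₗ (a := a) (i := i + 1) Γ.injective_subtype
      (LinearMap.exact_subtype_mkQ Γ) Γ.mkQ_surjective x).1 hx
    rw [Subsingleton.elim y 0, _root_.map_zero]
  · intro x
    exact (exact_mapₗ_deltaₗ (a := a) (i := i + 1) Γ.injective_subtype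
      (LinearMap.exact_subtype_mkQ Γ) Γ.mkQ_surjective x).1 (Subsingleton.elim _ _)

theorem subsingleton_of_supportDim_lt [IsNoetherianRing R] [IsNoetherianRing S] (i : ℕ)
    (N : Type) [AddCommGroup N] [Module R N] [Module S N] [IsScalarTower R S N]
    [Module.Finite S N] (h : Module.supportDim S N < i) : Subsingleton (LimExt a i N) := by
  induction i generalizing N with
  | zero =>
    have : Subsingleton N := by
      by_contra hN
      rw [not_subsingleton_iff_nontrivial] at hN
      have h1 := Module.supportDim_ne_bot_of_nontrivial S N
      have h2 : 0 ≤ Module.supportDim S N := by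
        have : Nonempty (Module.support S N) := Module.nonempty_support_of_nontrivial.to_subtype
        exact Order.krullDim_nonneg
      exact absurd h (not_lt.2 (by simpa using h2))
    exact subsingleton_of_subsingleton 0
  | succ i ih =>
    obtain ⟨Γ, k, r, hk, hr, hreg⟩ := exists_torsion_submodule_regular_quotient (S := S) a N
    have hbij := bijective_mapₗ_mkQ (pow_le_annihilator_of_map hk) i
    refine (Equiv.ofBijective _ hbij).subsingleton_congr.2 ?_
    have h0 : Module.supportDim S (N ⧸ Γ) < (i + 1 : ℕ) :=
      (Module.supportDim_le_of_surjective Γ.mkQ Γ.mkQ_surjective).trans_lt h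
    have h1 := Module.supportDim_quotSMulTop_succ_le_of_notMem_minimalPrimes
      (fun p hp => hreg.notMem_of_mem_minimalPrimes hp)
    have h2 : Module.supportDim S (QuotSMulTop (algebraMap R S r) (N ⧸ Γ)) < (i : ℕ) := by
      have h3 := h1.trans_lt h0
      rw [Nat.cast_succ] at h3
      exact lt_of_add_lt_add_right h3
    have h3 := ih _ h2
    refine subsingleton_of_forall_eq 0 fun x => ?_
    obtain ⟨t, ht⟩ := exists_pow_smul_eq_zero' (S := S) hr x
    have hinj : ∀ y : LimExt a (i + 1) (N ⧸ Γ), algebraMap R S r • y = 0 → y = 0 := by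
      intro y hy
      obtain ⟨z, rfl⟩ := (exact_deltaₗ_mapₗ (a := a) (i := i)
        (f := LinearMap.lsmul S (N ⧸ Γ) (algebraMap R S r)) hreg (exact_lsmul_mkQ _)
        (Submodule.mkQ_surjective _) y).1 hy
      rw [h3.elim z 0, _root_.map_zero]
    induction t with
    | zero => simpa using ht
    | succ t iht =>
      rw [pow_succ', mul_smul] at ht
      exact iht (hinj _ ht)

end LimExt

end

theorem isArtinian_of_pow_maximalIdeal_le_annihilator {C X : Type*} [CommRing C] [IsLocalRing C]
    [IsNoetherianRing C] [AddCommGroup X] [Module C X] [Module.Finite C X] {k : ℕ}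
    (hk : IsLocalRing.maximalIdeal C ^ k ≤ Module.annihilator C X) : IsArtinian C X := by
  nontriviality X
  let := Module.quotientAnnihilator (R := C) (M := X)
  have : IsScalarTower C (C ⧸ Module.annihilator C X) X :=
    (Module.isTorsionBySet_annihilator C X).isScalarTower
  have hne : Module.annihilator C X ≠ ⊤ := by
    rw [Ne, Module.annihilator_eq_top_iff]
    exact not_subsingleton X
  have : Nontrivial (C ⧸ Module.annihilator C X) := Ideal.Quotient.nontrivial_iff.2 hne
  have : IsLocalRing (C ⧸ Module.annihilator C X) :=
    .of_surjective' _ Ideal.Quotient.mk_surjective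
  have : IsArtinianRing (C ⧸ Module.annihilator C X) := by
    rw [isArtinianRing_iff_isNilpotent_maximalIdeal]
    refine ⟨k, ?_⟩
    rw [← IsLocalRing.map_maximalIdeal_of_surjective _ Ideal.Quotient.mk_surjective,
      ← Ideal.map_pow, Ideal.zero_eq_bot, Ideal.map_eq_bot_iff_le_ker, Ideal.mk_ker]
    exact hk
  have : Module.Finite (C ⧸ Module.annihilator C X) X :=
    Module.Finite.of_restrictScalars_finite C _ X
  exact isArtinian_of_surjective_algebraMap (R := C ⧸ Module.annihilator C X)
    Ideal.Quotient.mk_surjective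

namespace LimExt

theorem subsingleton_zero_of_regular {R : Type} [CommRing R] {a : Ideal R} {C : Type} [CommRing C]
    [Algebra R C] {N : Type} [AddCommGroup N] [Module R N]
    [Module C N] [IsScalarTower R C N] {r : R} (hr : r ∈ a)
    (hreg : IsSMulRegular N (algebraMap R C r)) : Subsingleton (LimExt a 0 N) := by
  refine subsingleton_of_forall_eq 0 fun x => ?_
  obtain ⟨t, ht⟩ := exists_pow_smul_eq_zero' (S := C) hr x
  have hinj : ∀ y : LimExt a 0 N, algebraMap R C r • y = 0 → y = 0 := fun y hy =>
    (injective_iff_map_eq_zero _).1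
      (mapₗ_injective_zero (a := a) (f := LinearMap.lsmul C N (algebraMap R C r)) hreg) y hy
  induction t with
  | zero => simpa using ht
  | succ t iht =>
    rw [pow_succ', mul_smul] at ht
    exact iht (hinj _ ht)

theorem exists_maximalIdeal_pow_le {R : Type} [CommRing R] {a : Ideal R} {C : Type} [CommRing C]
    [Algebra R C] [IsLocalRing C] [IsNoetherianRing C]
    (hC : (a.map (algebraMap R C)).radical = IsLocalRing.maximalIdeal C) {I : Ideal C} {k : ℕ}
    (h : (a.map (algebraMap R C)) ^ k ≤ I) : ∃ l, IsLocalRing.maximalIdeal C ^ l ≤ I := by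
  obtain ⟨l, hl⟩ := Ideal.exists_pow_le_of_le_radical_of_fg (I := IsLocalRing.maximalIdeal C)
    hC.ge (IsNoetherian.noetherian _)
  exact ⟨l * k, (pow_mul _ l k).le.trans ((Ideal.pow_right_mono hl k).trans h)⟩

variable {R : Type} [CommRing R] [IsNoetherianRing R] {a : Ideal R} {C : Type} [CommRing C]
  [Algebra R C] [IsLocalRing C] [IsNoetherianRing C]

/-- Local cohomology is Artinian if the radical of `a C` is the maximal ideal. -/
theorem isArtinian (hC : (a.map (algebraMap R C)).radical = IsLocalRing.maximalIdeal C) (i : ℕ)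
    (N : Type) [AddCommGroup N] [Module R N] [Module C N] [IsScalarTower R C N]
    [Module.Finite C N] : IsArtinian C (LimExt a i N) := by
  induction i generalizing N with
  | zero =>
    obtain ⟨Γ, k, r, hk, hr, hreg⟩ := exists_torsion_submodule_regular_quotient (R := R) (S := C) a N
    have h0 := subsingleton_zero_of_regular (a := a) hr hreg
    obtain ⟨l, hl⟩ := exists_maximalIdeal_pow_le hC hk
    have := isArtinian_of_pow_maximalIdeal_le_annihilator hl
    refine isArtinian_of_surjective _ ((mapₗ a 0 Γ.subtype).comp
      (zeroOf a (pow_le_annihilator_of_map hk))) ?_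
    rw [LinearMap.coe_comp]
    refine Function.Surjective.comp (fun x => ?_) (zeroOf_surjective a _)
    exact (exact_mapₗ (a := a) (i := 0) Γ.injective_subtype
      (LinearMap.exact_subtype_mkQ Γ) Γ.mkQ_surjective x).1 (Subsingleton.elim _ _)
  | succ i ih =>
    obtain ⟨Γ, k, r, hk, hr, hreg⟩ := exists_torsion_submodule_regular_quotient (R := R) (S := C) a N
    have hbij := bijective_mapₗ_mkQ (pow_le_annihilator_of_map hk) i
    refine (LinearEquiv.ofBijective _ hbij).isArtinian_iff.2 ?_
    have := ih (QuotSMulTop (algebraMap R C r) (N ⧸ Γ))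
    have hex := exact_deltaₗ_mapₗ (a := a) (i := i)
        (f := LinearMap.lsmul C (N ⧸ Γ) (algebraMap R C r)) hreg (exact_lsmul_mkQ _)
        (Submodule.mkQ_surjective _)
    have : IsArtinian C (LinearMap.ker
        (LinearMap.lsmul C (LimExt a (i + 1) (N ⧸ Γ)) (algebraMap R C r))) := by
      have h1 : LinearMap.ker (LinearMap.lsmul C (LimExt a (i + 1) (N ⧸ Γ)) (algebraMap R C r)) =
          LinearMap.range (deltaₗ a i (f := LinearMap.lsmul C (N ⧸ Γ) (algebraMap R C r)) hreg
            (exact_lsmul_mkQ _) (Submodule.mkQ_surjective _)) := by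
        rw [← LinearMap.exact_iff.1 hex]
        rfl
      rw [h1]
      infer_instance
    exact isArtinian_of_ker_smul (algebraMap R C r) (exists_pow_smul_eq_zero' hr)

end LimExt

namespace LimExt

theorem add_one_cancel_of_natCast {y : WithBot ℕ∞} {n : ℕ}
    (h : y + 1 = (n : WithBot ℕ∞) + 1) : y = n := by
  induction y with
  | bot => exact absurd h (by rw [WithBot.bot_add]; exact_mod_cast WithBot.bot_ne_coe)
  | coe y =>
    induction y with
    | top =>
      exfalso
      have h' : ((⊤ + 1 : ℕ∞) : WithBot ℕ∞) = ((n + 1 : ℕ) : ℕ∞) := by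
        exact_mod_cast h
      have := WithBot.coe_injective h'
      simp at this
      exact ENat.top_ne_natCast _ this
    | coe k =>
      have h' : k + 1 = n + 1 := by exact_mod_cast h
      have : k = n := by omega
      subst this
      rfl

theorem supportDim_quotient_eq {R : Type} [CommRing R] {a : Ideal R} {C : Type} [CommRing C]
    [Algebra R C] [IsLocalRing C] {N : Type} [AddCommGroup N] [Module C N] [Module.Finite C N]
    (hC : (a.map (algebraMap R C)).radical = IsLocalRing.maximalIdeal C) {Γ : Submodule C N} {k : ℕ}
    (hk : (a.map (algebraMap R C)) ^ k ≤ Module.annihilator C Γ) {n : ℕ}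
    (hN : Module.supportDim C N = (n + 1 : ℕ)) : Module.supportDim C (N ⧸ Γ) = (n + 1 : ℕ) := by
  have hsupp : ∀ p ∈ Module.support C Γ, p = IsLocalRing.closedPoint C := by
    intro p hp
    have h1 : (a.map (algebraMap R C)) ≤ p.asIdeal :=
      p.2.le_of_pow_le (hk.trans (Module.annihilator_le_of_mem_support hp))
    have h2 := (p.2.radical_le_iff).2 h1
    rw [hC] at h2
    exact PrimeSpectrum.ext
      ((IsLocalRing.maximalIdeal.isMaximal C).eq_of_le p.2.ne_top h2).symm
  have hun := Module.support_of_exact (LinearMap.exact_subtype_mkQ Γ) Γ.injective_subtype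
    Γ.mkQ_surjective
  have hnt : Nontrivial (N ⧸ Γ) := by
    by_contra hcon
    rw [not_nontrivial_iff_subsingleton] at hcon
    rw [Module.support_eq_empty (M := N ⧸ Γ), Set.union_empty] at hun
    have : Subsingleton (Module.support C N) := by
      rw [hun]
      exact ⟨fun x y => Subtype.ext ((hsupp _ x.2).trans (hsupp _ y.2).symm)⟩
    have h1 : Module.supportDim C N ≤ 0 := Order.krullDim_nonpos_of_subsingleton
    rw [hN] at h1
    norm_cast at h1
  have heq : Module.support C N = Module.support C (N ⧸ Γ) := by
    rw [hun, Set.union_eq_right]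
    intro p hp
    rw [hsupp p hp]
    exact IsLocalRing.closedPoint_mem_support C _
  rw [← hN, Module.supportDim, Module.supportDim, heq]

variable {R : Type} [CommRing R] [IsNoetherianRing R] {a : Ideal R} {C : Type} [CommRing C]
  [Algebra R C] [IsLocalRing C] [IsNoetherianRing C]

/-- The inductive step for the nonvanishing of local cohomology. -/
theorem nontrivial_succ_of_regular
    (hC : (a.map (algebraMap R C)).radical = IsLocalRing.maximalIdeal C) (n : ℕ)
    {N : Type} [AddCommGroup N] [Module R N] [Module C N] [IsScalarTower R C N]
    [Module.Finite C N] {r : R} (hr : r ∈ a) (hreg : IsSMulRegular N (algebraMap R C r))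
    (ih : ∀ x ∈ IsLocalRing.maximalIdeal C, IsSMulRegular N x →
      Nontrivial (LimExt a n (QuotSMulTop x N)) ∧
        (0 < n → ¬ Module.Finite C (LimExt a n (QuotSMulTop x N)))) :
    Nontrivial (LimExt a (n + 1) N) := by
  by_contra hcon
  rw [not_nontrivial_iff_subsingleton] at hcon
  have hart := isArtinian hC n N
  obtain ⟨s, hs, hfin⟩ := exists_finset_prime_finite_quotient (C := C) (X := LimExt a n N)
  have hprime : ∀ p ∈ associatedPrimes C N ∪ (s : Set (Ideal C)),
      p.IsPrime ∧ p ≠ IsLocalRing.maximalIdeal C := by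
    rintro p (hp | hp)
    · refine ⟨IsAssociatedPrime.isPrime hp, ?_⟩
      rintro rfl
      have h2 : algebraMap R C r ∈ ⋃ p ∈ associatedPrimes C N, (p : Set C) :=
        Set.mem_biUnion hp (hC ▸ Ideal.le_radical (Ideal.mem_map_of_mem _ hr))
      rw [biUnion_associatedPrimes_eq_compl_regular] at h2
      exact h2 hreg
    · exact hs p hp
  obtain ⟨x, hx, hxn⟩ : ∃ x ∈ IsLocalRing.maximalIdeal C,
      x ∉ ⋃ p ∈ associatedPrimes C N ∪ (s : Set (Ideal C)), (p : Set C) := by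
    by_contra! hcon
    obtain ⟨p, hp, hle⟩ := (Ideal.subset_union_prime_finite
      ((associatedPrimes.finite C N).union s.finite_toSet) (f := id) ⊤ ⊤
      fun p hp _ _ => (hprime p hp).1).1 hcon
    exact (hprime p hp).2
      ((IsLocalRing.maximalIdeal.isMaximal C).eq_of_le (hprime p hp).1.ne_top hle).symm
  have hxreg : IsSMulRegular N x := by
    by_contra hcon
    have h2 : x ∈ ⋃ p ∈ associatedPrimes C N, (p : Set C) := by
      rw [biUnion_associatedPrimes_eq_compl_regular]
      exact hcon
    exact hxn (Set.biUnion_mono Set.subset_union_left (fun _ _ => le_rfl) h2)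
  have hxs : ∀ p ∈ s, x ∉ p := fun p hp hxp => hxn (Set.mem_biUnion (Or.inr hp) hxp)
  have hfin' := hfin x hxs
  obtain ⟨hnt, hnf⟩ := ih x hx hxreg
  let π : N →ₗ[C] QuotSMulTop x N := Submodule.mkQ _
  have hsurj : Function.Surjective (mapₗ a n π) := fun y =>
    (exact_mapₗ_deltaₗ (a := a) (i := n) (f := LinearMap.lsmul C N x) hxreg
      (exact_lsmul_mkQ _) (Submodule.mkQ_surjective _) y).1 (hcon.elim _ _)
  have hex := exact_mapₗ (a := a) (i := n) (f := LinearMap.lsmul C N x) (g := π) hxreg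
      (exact_lsmul_mkQ _) (Submodule.mkQ_surjective _)
  rcases Nat.eq_zero_or_pos n with rfl | hpos
  · have := subsingleton_zero_of_regular (a := a) hr hreg
    have := hsurj.subsingleton
    exact not_subsingleton _ this
  · refine hnf hpos ?_
    have hle : LinearMap.range (LinearMap.lsmul C (LimExt a n N) x) ≤
        LinearMap.ker (mapₗ a n π) := by
      rintro _ ⟨y, rfl⟩
      exact (hex _).2 ⟨y, rfl⟩
    refine Module.Finite.of_surjective (Submodule.liftQ _ _ hle) ?_
    rw [← LinearMap.range_eq_top, Submodule.range_liftQ, LinearMap.range_eq_top]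
    exact hsurj

theorem not_finite_succ_of_regular
    (hC : (a.map (algebraMap R C)).radical = IsLocalRing.maximalIdeal C) (n : ℕ)
    {N : Type} [AddCommGroup N] [Module R N] [Module C N] [IsScalarTower R C N]
    [Module.Finite C N] {r : R} (hr : r ∈ a) (hreg : IsSMulRegular N (algebraMap R C r))
    (hdim : Module.supportDim C (QuotSMulTop (algebraMap R C r) N) = n)
    (hnt : Nontrivial (LimExt a (n + 1) N)) : ¬ Module.Finite C (LimExt a (n + 1) N) := by
  intro hfin'
  have hvan : Subsingleton (LimExt a (n + 1) (QuotSMulTop (algebraMap R C r) N)) := by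
    refine subsingleton_of_supportDim_lt (S := C) _ _ ?_
    rw [hdim]
    exact_mod_cast Nat.lt_succ_self n
  have hsurj : ∀ y : LimExt a (n + 1) N, ∃ z, algebraMap R C r • z = y := fun y =>
    (exact_mapₗ (a := a) (i := n + 1) (f := LinearMap.lsmul C N (algebraMap R C r)) hreg
        (exact_lsmul_mkQ _) (Submodule.mkQ_surjective _) y).1 (hvan.elim _ _)
  have hbot : (⊤ : Submodule C (LimExt a (n + 1) N)) = ⊥ := by
    refine Submodule.eq_bot_of_le_smul_of_le_jacobson_bot (IsLocalRing.maximalIdeal C) _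
      (Module.finite_def.1 hfin') ?_ (IsLocalRing.maximalIdeal_le_jacobson _)
    intro y _
    obtain ⟨z, rfl⟩ := hsurj y
    exact Submodule.smul_mem_smul (hC ▸ Ideal.le_radical (Ideal.mem_map_of_mem _ hr)) trivial
  exact not_subsingleton _ (subsingleton_of_bot_eq_top hbot.symm)

/-- Grothendieck nonvanishing, and failure of finite generation in positive dimension. -/
theorem nontrivial_and_not_finite
    (hC : (a.map (algebraMap R C)).radical = IsLocalRing.maximalIdeal C) (n : ℕ)
    (N : Type) [AddCommGroup N] [Module R N] [Module C N] [IsScalarTower R C N]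
    [Module.Finite C N] (hN : Module.supportDim C N = n) :
    Nontrivial (LimExt a n N) ∧ (0 < n → ¬ Module.Finite C (LimExt a n N)) := by
  have haC : a.map (algebraMap R C) ≤ IsLocalRing.maximalIdeal C := hC ▸ Ideal.le_radical
  have hra : ∀ r ∈ a, algebraMap R C r ∈ IsLocalRing.maximalIdeal C :=
    fun r hr => haC (Ideal.mem_map_of_mem _ hr)
  induction n generalizing N with
  | zero =>
    refine ⟨?_, fun h => absurd h (lt_irrefl _)⟩
    have hnt : Nontrivial N := by
      rw [← Module.supportDim_ne_bot_iff_nontrivial C, hN]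
      exact WithBot.coe_ne_bot
    have hs := support_of_supportDim_eq_zero C N hN
    rw [Module.support_eq_zeroLocus, PrimeSpectrum.zeroLocus_eq_iff] at hs
    obtain ⟨k, hk⟩ := Ideal.exists_pow_le_of_le_radical_of_fg (I := a.map (algebraMap R C))
      (J := Module.annihilator C N) (by
        rw [hs]
        exact haC.trans Ideal.le_radical) (IsNoetherian.noetherian _)
    exact (zeroOf_injective (S := C) a (pow_le_annihilator_of_map hk)).nontrivial
  | succ n ih =>
    obtain ⟨Γ, k, r, hk, hr, hreg⟩ := exists_torsion_submodule_regular_quotient (R := R) (S := C) a N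
    have hN' := supportDim_quotient_eq hC hk hN
    have hbij := bijective_mapₗ_mkQ (pow_le_annihilator_of_map hk) n
    have equiv := LinearEquiv.ofBijective _ hbij
    have hquot : ∀ x ∈ IsLocalRing.maximalIdeal C, IsSMulRegular (N ⧸ Γ) x →
        Module.supportDim C (QuotSMulTop x (N ⧸ Γ)) = n := by
      intro x hx hxreg
      have h1 := Module.supportDim_quotSMulTop_succ_eq_supportDim hxreg hx
      rw [hN', Nat.cast_succ] at h1
      exact add_one_cancel_of_natCast h1
    have hnt := nontrivial_succ_of_regular hC n hr hreg
      fun x hx hxreg => ih _ (hquot x hx hxreg)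
    refine ⟨equiv.toEquiv.nontrivial_congr.2 hnt, fun _ hfin => ?_⟩
    exact not_finite_succ_of_regular hC n hr hreg (hquot _ (hra r hr) hreg) hnt
      (Module.Finite.equiv equiv)

end LimExt

namespace AdicCompletion

/-- A surjective ring homomorphism induces a surjection of adic completions. -/
theorem exists_ringHom_surjective {P A : Type} [CommRing P] [CommRing A] {J : Ideal P} {I : Ideal A}
    (φ : P →+* A) (hφ : Function.Surjective φ) (hI : J.map φ = I) :
    ∃ ψ : AdicCompletion J P →+* AdicCompletion I A, Function.Surjective ψ := by
  have hle : ∀ n, J ^ n ≤ (I ^ n).comap φ := fun n => by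
    rw [← Ideal.map_le_iff_le_comap, Ideal.map_pow, hI]
  let f (n : ℕ) : AdicCompletion J P →+* A ⧸ I ^ n :=
    (Ideal.quotientMap (I ^ n) φ (hle n)).comp (evalₐ J n : AdicCompletion J P →+* P ⧸ J ^ n)
  have hmk (n : ℕ) (x : AdicCauchySequence J P) :
      f n (AdicCompletion.mk J P x) = Ideal.Quotient.mk (I ^ n) (φ (x n)) := by
    simp only [f, RingHom.comp_apply, RingHom.coe_coe, evalₐ_mk, Ideal.quotientMap_mk]
  have hf : ∀ {m n : ℕ} (h : m ≤ n), (Ideal.Quotient.factorPow I h).comp (f n) = f m := by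
    intro m n h
    ext x
    induction x using AdicCompletion.induction_on with
    | h x =>
      rw [RingHom.comp_apply, hmk, hmk]
      rw [Ideal.Quotient.factorPow, Ideal.Quotient.factor_mk, Ideal.Quotient.eq, ← map_sub]
      refine hle m ?_
      have := x.2 h
      rw [SModEq.comm, SModEq.sub_mem, smul_eq_mul, Ideal.mul_top] at this
      exact this
  refine ⟨liftRingHom I f hf, fun y => ?_⟩
  induction y using AdicCompletion.induction_on with
  | h y =>
    have hstep : ∀ n, ∃ j ∈ J ^ n, φ j = y (n + 1) - y n := fun n => by
      have h1 := y.2 (Nat.le_succ n)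
      rw [SModEq.comm, SModEq.sub_mem, smul_eq_mul, Ideal.mul_top] at h1
      have h2 : y (n + 1) - y n ∈ (J ^ n).map φ := by
        rw [Ideal.map_pow, hI]
        exact h1
      exact (Ideal.mem_map_iff_of_surjective φ hφ).1 h2
    choose j hj hφj using hstep
    obtain ⟨p₀, hp₀⟩ := hφ (y 0)
    let x : AdicCauchySequence J P := AdicCauchySequence.mk J P
      (fun n => p₀ + ∑ k ∈ Finset.range n, j k) fun n => by
        rw [SModEq.comm, SModEq.sub_mem, smul_eq_mul, Ideal.mul_top, Finset.sum_range_succ]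
        convert hj n using 1
        ring
    refine ⟨AdicCompletion.mk J P x, ext_evalₐ fun n => ?_⟩
    rw [evalₐ_liftRingHom, hmk, evalₐ_mk]
    congr 1
    change φ (p₀ + ∑ k ∈ Finset.range n, j k) = y n
    rw [map_add, map_sum, hp₀, Finset.sum_congr rfl (fun k _ => hφj k),
      Finset.sum_range_sub (fun k => y k)]
    ring

/-- Adic completions of Noetherian rings are Noetherian. -/
theorem isNoetherianRing {A : Type} [CommRing A] [IsNoetherianRing A] (I : Ideal A) :
    IsNoetherianRing (AdicCompletion I A) := by
  obtain ⟨n, x, hx⟩ := Submodule.fg_iff_exists_fin_generating_family.1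
    (IsNoetherian.noetherian (R := A) I)
  have : IsNoetherianRing (AdicCompletion (MvPolynomial.idealOfVars (Fin n) A)
      (MvPolynomial (Fin n) A)) :=
    isNoetherianRing_of_ringEquiv (MvPowerSeries (Fin n) A)
      (MvPowerSeries.toAdicCompletionAlgEquiv (Fin n) A).toRingEquiv
  obtain ⟨ψ, hψ⟩ := exists_ringHom_surjective (J := MvPolynomial.idealOfVars (Fin n) A) (I := I)
    (MvPolynomial.aeval x : MvPolynomial (Fin n) A →ₐ[A] A).toRingHom
    (fun r => ⟨MvPolynomial.C r, by simp⟩) (by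
      rw [MvPolynomial.idealOfVars, Ideal.map_span, ← Set.range_comp, ← hx]
      congr 2
      ext i
      simp)
  exact isNoetherianRing_of_surjective _ _ ψ hψ

end AdicCompletion

theorem Module.supportDim_le_of_annihilator_le {R M K : Type} [CommRing R] [AddCommGroup M]
    [Module R M] [Module.Finite R M] [AddCommGroup K] [Module R K] [Module.Finite R K]
    (h : Module.annihilator R M ≤ Module.annihilator R K) :
    Module.supportDim R K ≤ Module.supportDim R M := by
  rw [Module.supportDim_eq_ringKrullDim_quotient_annihilator,
    Module.supportDim_eq_ringKrullDim_quotient_annihilator]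
  exact ringKrullDim_le_of_surjective (Ideal.Quotient.factor h) (Ideal.Quotient.factor_surjective h)

namespace LimExt

/-- `LimExt` is right exact in the top degree. -/
theorem map_surjective_of_supportDim_le {R : Type} [CommRing R] [IsNoetherianRing R] {a : Ideal R}
    {d : ℕ} {L N : Type} [AddCommGroup L] [Module R L] [AddCommGroup N] [Module R N]
    [Module.Finite R L] (hd : Module.supportDim R L ≤ d) (f : L →ₗ[R] N)
    (hf : Function.Surjective f) : Function.Surjective (map a d f) := by
  intro y
  have hK : Subsingleton (LimExt a (d + 1) (LinearMap.ker f)) := by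
    refine subsingleton_of_supportDim_lt (S := R) _ _ ?_
    refine lt_of_le_of_lt ((Module.supportDim_le_of_injective _
      (LinearMap.ker f).injective_subtype).trans hd) ?_
    exact_mod_cast Nat.lt_succ_self d
  exact (exact_mapₗ_deltaₗ (S := R) (a := a) (i := d) (f := (LinearMap.ker f).subtype) (g := f)
    (LinearMap.ker f).injective_subtype (LinearMap.exact_subtype_ker_map f) hf y).1 (hK.elim _ _)

theorem map_sum {R : Type} [CommRing R] {a : Ideal R} {i : ℕ} {N N' : Type} [AddCommGroup N]
    [Module R N] [AddCommGroup N'] [Module R N'] {ι : Type} (s : Finset ι) (f : ι → N →ₗ[R] N')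
    (x : LimExt a i N) : map a i (∑ j ∈ s, f j) x = ∑ j ∈ s, map a i (f j) x :=
  _root_.map_sum (AddMonoidHom.mk' (fun f => map a i f x) fun f g => map_add' f g x) f s

/-- In the top degree, base change generates `LimExt`. -/
theorem span_range_map {R : Type} [CommRing R] [IsNoetherianRing R] {a : Ideal R}
    {d : ℕ} {M : Type} [AddCommGroup M] [Module R M] [Module.Finite R M]
    (hd : Module.supportDim R M ≤ d) {S : Type} [CommRing S] [Algebra R S] {T : Type}
    [AddCommGroup T] [Module R T] [Module S T] [IsScalarTower R S T] (g : M →ₗ[R] T)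
    (hg : Submodule.span S (Set.range g) = ⊤) :
    Submodule.span S (Set.range (map a d g)) = ⊤ := by
  rw [eq_top_iff]
  intro x _
  obtain ⟨T₀, hT₀, y, rfl⟩ := exists_fg_map_eq x
  have htop : ⨆ s : S, LinearMap.range (smulMap R T s ∘ₗ g) = ⊤ := by
    rw [eq_top_iff]
    intro t _
    have ht : t ∈ Submodule.span S (Set.range g) := hg ▸ Submodule.mem_top
    induction ht using Submodule.span_induction with
    | mem t ht =>
      obtain ⟨m, rfl⟩ := ht
      exact Submodule.mem_iSup_of_mem 1 ⟨m, by simp⟩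
    | zero => exact Submodule.zero_mem _
    | add x y _ _ hx hy => exact Submodule.add_mem _ (hx trivial) (hy trivial)
    | smul s x _ hx =>
      have h1 : ⨆ s : S, LinearMap.range (smulMap R T s ∘ₗ g) ≤
          (⨆ s : S, LinearMap.range (smulMap R T s ∘ₗ g)).comap (smulMap R T s) := by
        refine iSup_le fun s' => ?_
        rintro _ ⟨m, rfl⟩
        exact Submodule.mem_iSup_of_mem (s * s') ⟨m, by simp [mul_smul]⟩
      exact h1 (hx trivial)
  obtain ⟨F, hF⟩ := CompleteLattice.IsCompactElement.exists_finset_of_le_iSup _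
    ((Submodule.fg_iff_compact _).1 hT₀) (fun s : S => LinearMap.range (smulMap R T s ∘ₗ g))
    (htop ▸ le_top)
  let h : (F → M) →ₗ[R] T := ∑ s : F, smulMap R T (s : S) ∘ₗ g ∘ₗ LinearMap.proj s
  have hrange : T₀ ≤ LinearMap.range h := by
    classical
    refine hF.trans (iSup₂_le fun s hs => ?_)
    rintro _ ⟨m, rfl⟩
    refine ⟨Pi.single ⟨s, hs⟩ m, ?_⟩
    simp only [h, LinearMap.sum_apply, LinearMap.comp_apply, LinearMap.proj_apply]
    rw [Finset.sum_eq_single ⟨s, hs⟩]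
    · simp
    · intro s' _ hs'
      simp [Pi.single_eq_of_ne hs']
    · simp
  have hsurj := map_surjective_of_supportDim_le (a := a) (d := d) (f := h.rangeRestrict) (by
    refine (Module.supportDim_le_of_annihilator_le (M := M) ?_).trans hd
    intro r hr
    rw [Module.mem_annihilator] at hr ⊢
    exact fun v => funext fun s => hr _) h.surjective_rangeRestrict
  obtain ⟨z, hz⟩ := hsurj (map a d (Submodule.inclusion hrange) y)
  have hz' : map a d T₀.subtype y = map a d h z := by
    have := congrArg (map a d (LinearMap.range h).subtype) hz
    rw [map_map, map_map] at this
    exact this.symm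
  rw [hz', map_sum]
  refine Submodule.sum_mem _ fun s _ => ?_
  rw [← map_map, ← map_map, ← smul_eq_map]
  exact Submodule.smul_mem _ _ (Submodule.subset_span ⟨_, rfl⟩)

end LimExt

namespace CategoryTheory

open Opposite

section

variable {R : Type} [CommRing R]

/-- The precomposition map on the complexes `Hom(P, Y)`. -/
noncomputable def linearYonedaObjMap {P' P : ChainComplex (ModuleCat.{0} R) ℕ} (φ : P' ⟶ P)
    (Y : ModuleCat.{0} R) : P.linearYonedaObj R Y ⟶ P'.linearYonedaObj R Y :=
  (HomologicalComplex.unopFunctor _ _).map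
    (((((linearYoneda R (ModuleCat.{0} R)).obj Y).rightOp.mapHomologicalComplex _).map φ).op)

theorem inv_comp_eq_comp_inv {V : Type*} [Category V] {A B A' B' : V} {α : A ≅ B} {β : A' ≅ B'}
    {f : A ⟶ A'} {g : B ⟶ B'} (h : f ≫ β.hom = α.hom ≫ g) : α.inv ≫ f = g ≫ β.inv := by
  rw [Iso.inv_comp_eq, ← Category.assoc, ← h, Category.assoc, Iso.hom_inv_id, Category.comp_id]

theorem homologyUnop_inv_naturality {V : Type*} [Category V] [Abelian V] {ι : Type*}
    {c : ComplexShape ι} {K L : HomologicalComplex Vᵒᵖ c} (φ : K ⟶ L) (i : ι) :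
    (HomologicalComplex.homologyMap φ i).unop ≫ (K.homologyUnop i).inv =
      (L.homologyUnop i).inv ≫
        HomologicalComplex.homologyMap ((HomologicalComplex.unopFunctor _ _).map φ.op) i :=
  congrArg Quiver.Hom.unop (inv_comp_eq_comp_inv (HomologicalComplex.homologyOp_hom_naturality
    ((HomologicalComplex.unopFunctor _ _).map φ.op) i))

theorem isoExt_naturality {X' X : ModuleCat.{0} R} {g : X' ⟶ X} (P' : ProjectiveResolution X')
    (P : ProjectiveResolution X) (φ : ProjectiveResolution.Hom P' P g) (n : ℕ) (Y : ModuleCat.{0} R) :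
    ((Ext R (ModuleCat.{0} R) n).map g.op).app Y ≫ (P'.isoExt (R := R) n Y).hom =
      (P.isoExt (R := R) n Y).hom ≫
        HomologicalComplex.homologyMap (linearYonedaObjMap φ.hom Y) n := by
  have h := congrArg Quiver.Hom.unop (inv_comp_eq_comp_inv
    (ProjectiveResolution.isoLeftDerivedObj_hom_naturality g P' P φ.hom
    (by rw [φ.hom_f_zero_comp_π_f_zero]; simp)
    ((linearYoneda R (ModuleCat.{0} R)).obj Y).rightOp n))
  have h2 := homologyUnop_inv_naturality
    ((((linearYoneda R (ModuleCat.{0} R)).obj Y).rightOp.mapHomologicalComplex _).map φ.hom) n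
  refine (Category.assoc _ _ _).symm.trans ((congrArg (· ≫ _) h).trans ?_)
  refine (Category.assoc _ _ _).trans (Eq.trans ?_ (Category.assoc _ _ _).symm)
  exact congrArg (_ ≫ ·) h2

end

end CategoryTheory

namespace CategoryTheory

section

variable {R : Type} [CommRing R]

/-- The underlying morphism of a cycle in the complex `Hom(P, Y)`. -/
noncomputable def cyclesHom (P : ChainComplex (ModuleCat.{0} R) ℕ) (Y : ModuleCat.{0} R) (n : ℕ)
    (z : (P.linearYonedaObj R Y).cycles n) : P.X n ⟶ Y :=
  (P.linearYonedaObj R Y).iCycles n z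

theorem d_comp_cyclesHom (P : ChainComplex (ModuleCat.{0} R) ℕ) (Y : ModuleCat.{0} R) (n : ℕ)
    (z : (P.linearYonedaObj R Y).cycles n) : P.d (n + 1) n ≫ cyclesHom P Y n z = 0 :=
  ConcreteCategory.congr_hom ((P.linearYonedaObj R Y).iCycles_d n (n + 1)) z

theorem exists_cyclesHom_eq (P : ChainComplex (ModuleCat.{0} R) ℕ) (Y : ModuleCat.{0} R) (n : ℕ)
    (f : P.X n ⟶ Y) (hf : P.d (n + 1) n ≫ f = 0) : ∃ z, cyclesHom P Y n z = f := by
  let K := P.linearYonedaObj R Y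
  let F : ModuleCat.of R R ⟶ K.X n := ModuleCat.ofHom (LinearMap.toSpanSingleton R (K.X n) f)
  have hF : F ≫ K.d n (n + 1) = 0 := by
    ext
    exact (congrArg (K.d n (n + 1)) (one_smul R f)).trans hf
  refine ⟨K.liftCycles F (n + 1) (by simp) hF (1 : R), ?_⟩
  exact (ConcreteCategory.congr_hom (K.liftCycles_i F (n + 1) (by simp) hF) (1 : R)).trans
    (one_smul R f)

variable {X : ModuleCat.{0} R} (P : ProjectiveResolution X) (Y : ModuleCat.{0} R) (n : ℕ)

/-- The map from cocycles of `Hom(P, Y)` to the Yoneda-type `Ext` group. -/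
noncomputable def cyclesToExt : (P.complex.linearYonedaObj R Y).cycles n →ₗ[R]
    Abelian.Ext X Y n where
  toFun z := P.extMk (cyclesHom P.complex Y n z) (n + 1) rfl (d_comp_cyclesHom _ _ _ _)
  map_add' z w := by
    rw [ProjectiveResolution.add_extMk]
    congr 1
    exact map_add ((P.complex.linearYonedaObj R Y).iCycles n).hom z w
  map_smul' r z := by
    rw [RingHom.id_apply, Abelian.Ext.smul_eq_comp_mk₀, ProjectiveResolution.extMk_comp_mk₀]
    congr 1
    refine (map_smul ((P.complex.linearYonedaObj R Y).iCycles n).hom r z).trans ?_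
    change r • cyclesHom P.complex Y n z = _
    rw [Linear.comp_smul, Category.comp_id]

theorem cyclesToExt_surjective : Function.Surjective (cyclesToExt P Y n) := fun e => by
  obtain ⟨f, hf, rfl⟩ := P.extMk_surjective e (n + 1) rfl
  obtain ⟨z, rfl⟩ := exists_cyclesHom_eq P.complex Y n f hf
  exact ⟨z, rfl⟩

theorem toCycles_comp_cyclesToExt (p : ℕ) :
    (P.complex.linearYonedaObj R Y).toCycles p (p + 1) ≫
      ModuleCat.ofHom (cyclesToExt P Y (p + 1)) = 0 := by
  ext (f : P.complex.X p ⟶ Y)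
  refine (P.extMk_eq_zero_iff _ _ rfl (d_comp_cyclesHom _ _ _ _) p rfl).2 ⟨f, ?_⟩
  exact (ConcreteCategory.congr_hom ((P.complex.linearYonedaObj R Y).toCycles_i p (p + 1)) f).symm

/-- The map from the cohomology of `Hom(P, Y)` to the Yoneda-type `Ext` group. -/
noncomputable def homologyToExt (p : ℕ) : (P.complex.linearYonedaObj R Y).homology (p + 1) ⟶
    ModuleCat.of R (Abelian.Ext X Y (p + 1)) :=
  ((P.complex.linearYonedaObj R Y).homologyIsCokernel p (p + 1) (by simp)).desc
    (Limits.CokernelCofork.ofπ _ (toCycles_comp_cyclesToExt P Y p))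

theorem π_homologyToExt (p : ℕ) :
    (P.complex.linearYonedaObj R Y).homologyπ (p + 1) ≫ homologyToExt P Y p =
      ModuleCat.ofHom (cyclesToExt P Y (p + 1)) :=
  Limits.Cofork.IsColimit.π_desc
    ((P.complex.linearYonedaObj R Y).homologyIsCokernel p (p + 1) (by simp))

theorem homologyToExt_surjective (p : ℕ) : Function.Surjective (homologyToExt P Y p) := fun e => by
  obtain ⟨z, rfl⟩ := cyclesToExt_surjective P Y (p + 1) e
  exact ⟨_, ConcreteCategory.congr_hom (π_homologyToExt P Y p) z⟩

variable {P} in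
theorem homologyToExt_naturality {X' : ModuleCat.{0} R} {g : X' ⟶ X} {P' : ProjectiveResolution X'}
    (φ : ProjectiveResolution.Hom P' P g) (p : ℕ)
    (x : (P.complex.linearYonedaObj R Y).homology (p + 1)) :
    homologyToExt P' Y p (HomologicalComplex.homologyMap (linearYonedaObjMap φ.hom Y) (p + 1) x) =
      (Abelian.Ext.mk₀ g).comp (homologyToExt P Y p x : Abelian.Ext X Y (p + 1)) (zero_add _) := by
  obtain ⟨z, rfl⟩ := (ModuleCat.epi_iff_surjective
    ((P.complex.linearYonedaObj R Y).homologyπ (p + 1))).1 inferInstance x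
  have h1 := ConcreteCategory.congr_hom (HomologicalComplex.homologyπ_naturality
    (linearYonedaObjMap φ.hom Y) (p + 1)) z
  have h2 := ConcreteCategory.congr_hom (HomologicalComplex.cyclesMap_i
    (linearYonedaObjMap φ.hom Y) (p + 1)) z
  refine (congrArg (homologyToExt P' Y p) h1).trans ?_
  refine (ConcreteCategory.congr_hom (π_homologyToExt P' Y p) _).trans ?_
  refine Eq.trans ?_ (congrArg (fun e : Abelian.Ext X Y (p + 1) =>
    (Abelian.Ext.mk₀ g).comp e (zero_add _))
    (ConcreteCategory.congr_hom (π_homologyToExt P Y p) z)).symm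
  refine Eq.trans ?_ (ProjectiveResolution.mk₀_comp_extMk (cyclesHom P.complex Y (p + 1) z) _ rfl
    (d_comp_cyclesHom _ _ _ _) φ).symm
  change P'.extMk _ _ rfl (d_comp_cyclesHom _ _ _ _) = _
  congr 1

/-- The comparison map from derived-functor `Ext` to Yoneda-type `Ext`. -/
noncomputable def extToExt (X Y : ModuleCat.{0} R) (p : ℕ) :
    ((Ext R (ModuleCat.{0} R) (p + 1)).obj (Opposite.op X)).obj Y ⟶
      ModuleCat.of R (Abelian.Ext X Y (p + 1)) :=
  ((projectiveResolution X).isoExt (p + 1) Y).hom ≫ homologyToExt (projectiveResolution X) Y p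

theorem extToExt_surjective (X Y : ModuleCat.{0} R) (p : ℕ) :
    Function.Surjective (extToExt X Y p) := fun e => by
  obtain ⟨x, rfl⟩ := homologyToExt_surjective (projectiveResolution X) Y p e
  refine ⟨((projectiveResolution X).isoExt (R := R) (p + 1) Y).inv x, ?_⟩
  exact congrArg (homologyToExt (projectiveResolution X) Y p) (ConcreteCategory.congr_hom
    ((projectiveResolution X).isoExt (R := R) (p + 1) Y).inv_hom_id x)

theorem extToExt_naturality {X' X : ModuleCat.{0} R} (g : X' ⟶ X) (Y : ModuleCat.{0} R) (p : ℕ)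
    (x : ((Ext R (ModuleCat.{0} R) (p + 1)).obj (Opposite.op X)).obj Y) :
    extToExt X' Y p (((Ext R (ModuleCat.{0} R) (p + 1)).map g.op).app Y x) =
      (Abelian.Ext.mk₀ g).comp (extToExt X Y p x : Abelian.Ext X Y (p + 1)) (zero_add _) := by
  let φ : ProjectiveResolution.Hom (projectiveResolution X') (projectiveResolution X) g :=
    ⟨ProjectiveResolution.lift g _ _, by
      rw [ProjectiveResolution.lift_commutes_zero]; simp⟩
  refine (congrArg (homologyToExt (projectiveResolution X') Y p) (ConcreteCategory.congr_hom
    (isoExt_naturality (projectiveResolution X') (projectiveResolution X) φ (p + 1) Y) x)).trans ?_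
  exact homologyToExt_naturality Y φ p _

end

end CategoryTheory

namespace LimExt

open Limits Opposite

/-- Evaluating a colimit of functors. -/
theorem exists_surjective_of_colimit {R : Type} [CommRing R] {J : Type} [SmallCategory J]
    (F : J ⥤ ModuleCat.{0} R ⥤ ModuleCat.{0} R) (M L : ModuleCat.{0} R)
    (φ : ∀ j, (F.obj j).obj M ⟶ L) (hφ : ∀ {j k} (f : j ⟶ k), (F.map f).app M ≫ φ k = φ j)
    (hs : ∀ y : L, ∃ j x, φ j x = y) :
    ∃ f : (colimit F).obj M →ₗ[R] L, Function.Surjective f := by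
  let c : Cocone (F ⋙ (evaluation _ _).obj M) :=
    { pt := L
      ι := { app := φ, naturality := fun j k f => (hφ f).trans (Category.comp_id _).symm } }
  have hc := isColimitOfPreserves ((evaluation _ _).obj M) (colimit.isColimit F)
  refine ⟨(hc.desc c).hom, fun y => ?_⟩
  obtain ⟨j, x, rfl⟩ := hs y
  exact ⟨_, ConcreteCategory.congr_hom (hc.fac c j) x⟩

theorem exists_localCohomology_surjective {R : Type} [CommRing R] (a : Ideal R) (p : ℕ)
    (M : Type) [AddCommGroup M] [Module R M] :
    ∃ f : (localCohomology a (p + 1)).obj (ModuleCat.of R M) →ₗ[R] LimExt a (p + 1) M,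
      Function.Surjective f := by
  let g (t : ℕ) : PowExt a (p + 1) M t →ₗ[R] LimExt a (p + 1) M :=
    { of a (p + 1) M t with map_smul' := fun r e => (smul_of' r e).symm }
  refine exists_surjective_of_colimit
    (localCohomology.diagram (localCohomology.idealPowersDiagram a) (p + 1)) (ModuleCat.of R M)
    (ModuleCat.of R (LimExt a (p + 1) M))
    (fun j => extToExt (powQuot a j.unop.unop) (ModuleCat.of R M) p ≫
      ModuleCat.ofHom (g j.unop.unop)) ?_ ?_
  · intro j k f
    ext x
    refine (congrArg (g k.unop.unop) (extToExt_naturality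
      (powQuotMap a (leOfHom f.unop.unop)) (ModuleCat.of R M) p x)).trans ?_
    exact of_comp _ _
  · intro y
    obtain ⟨t, e, rfl⟩ := exists_of y
    obtain ⟨x, rfl⟩ := extToExt_surjective _ _ p e
    exact ⟨op (op t), x, rfl⟩

end LimExt

/-- If the localization of `H` is finitely generated, then so is any module over a larger ring
generated by an image of `H`. -/
theorem Module.Finite.of_localizedModule {R A C H L : Type*} [CommRing R] [CommRing A]
    [CommRing C] [Algebra R A] [Algebra A C] (S : Submonoid R) [IsLocalization S A]
    [AddCommGroup H] [Module R H] [AddCommGroup L] [Module R L] [Module A L] [Module C L]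
    [IsScalarTower R A L] [IsScalarTower A C L]
    [Module A (LocalizedModule S H)] [IsScalarTower R A (LocalizedModule S H)]
    [Module.Finite A (LocalizedModule S H)] (h : H →ₗ[R] L)
    (hspan : Submodule.span C (Set.range h) = ⊤) : Module.Finite C L := by
  have hu (s : S) : IsUnit (algebraMap R (Module.End R L) s) := by
    rw [Module.End.isUnit_iff]
    obtain ⟨u, hu⟩ := IsLocalization.map_units A s
    have hs (x : L) : (s : R) • x = (u : A) • x := by rw [hu, algebraMap_smul]
    refine Function.bijective_iff_has_inverse.2 ⟨fun x => (↑u⁻¹ : A) • x, fun x => ?_, fun x => ?_⟩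
    · simp only [Module.algebraMap_end_apply, hs, smul_smul, Units.inv_mul, one_smul]
    · simp only [Module.algebraMap_end_apply, hs, smul_smul, Units.mul_inv, one_smul]
  let l : LocalizedModule S H →ₗ[A] L :=
    (LocalizedModule.lift S h hu).extendScalarsOfIsLocalization S A
  have hl (x : H) : l (LocalizedModule.mkLinearMap S H x) = h x :=
    LinearMap.congr_fun (LocalizedModule.lift_comp S h hu) x
  obtain ⟨s, hs⟩ := Module.finite_def.1 ‹Module.Finite A (LocalizedModule S H)›
  classical
  refine ⟨⟨s.image l, ?_⟩⟩
  rw [eq_top_iff, ← hspan, Submodule.span_le]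
  rintro _ ⟨x, rfl⟩
  have hx : h x ∈ Submodule.span A (l '' s) := by
    rw [← Submodule.map_span, hs, ← hl]
    exact ⟨_, trivial, rfl⟩
  rw [Finset.coe_image]
  exact Submodule.span_subset_span A C _ hx

namespace LimExt

/-- If `H` maps onto `LimExt` in the top degree `d` and `C` is a suitable local algebra over the
localization `A`, then the localization of `H` is not finitely generated. -/
theorem not_finite_localizedModule {R A C : Type} [CommRing R] [IsNoetherianRing R] [CommRing A]
    [CommRing C] [IsLocalRing C] [IsNoetherianRing C] [Algebra R A] [Algebra A C] [Algebra R C]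
    [IsScalarTower R A C] (S : Submonoid R) [IsLocalization S A] {a : Ideal R} {d : ℕ} (hd0 : 0 < d)
    (hC : (a.map (algebraMap R C)).radical = IsLocalRing.maximalIdeal C)
    {M : Type} [AddCommGroup M] [Module R M] [Module.Finite R M]
    (hM : Module.supportDim R M ≤ d) (hT : Module.supportDim C (C ⊗[R] M) = d)
    {H : Type*} [AddCommGroup H] [Module R H] [Module A (LocalizedModule S H)]
    [IsScalarTower R A (LocalizedModule S H)]
    (f : H →ₗ[R] LimExt a d M) (hf : Function.Surjective f) :
    ¬ Module.Finite A (LocalizedModule S H) := by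
  intro hfin
  let g : M →ₗ[R] C ⊗[R] M := TensorProduct.mk R C M 1
  have hg : Submodule.span C (Set.range g) = ⊤ := by
    rw [eq_top_iff]
    rintro x -
    induction x with
    | zero => exact zero_mem _
    | add x y hx hy => exact add_mem hx hy
    | tmul c x =>
      rw [← mul_one c, ← smul_eq_mul, ← TensorProduct.smul_tmul']
      exact Submodule.smul_mem _ _ (Submodule.subset_span ⟨x, rfl⟩)
  have hspan : Submodule.span C (Set.range (mapₗ a d g ∘ₗ f)) = ⊤ := by
    rw [LinearMap.coe_comp, Set.range_comp, hf.range_eq, Set.image_univ]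
    exact span_range_map hM g hg
  exact (nontrivial_and_not_finite hC d (C ⊗[R] M) hT).2 hd0
    (Module.Finite.of_localizedModule (A := A) S (mapₗ a d g ∘ₗ f) hspan)

end LimExt

namespace IsLocalRing

theorem ringKrullDim_le_of_map_eq_maximalIdeal {D C : Type*} [CommRing D] [CommRing C]
    [IsNoetherianRing D] [IsNoetherianRing C] [IsLocalRing C] [Algebra D C] (n : Ideal D)
    (hn : n.map (algebraMap D C) = maximalIdeal C) : ringKrullDim C ≤ ringKrullDim D := by
  let q := (maximalIdeal C).comap (algebraMap D C)
  have hq : q.map (algebraMap D C) = maximalIdeal C :=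
    le_antisymm Ideal.map_comap_le (hn ▸ Ideal.map_mono (Ideal.le_comap_of_map_le hn.le))
  have : (maximalIdeal C).LiesOver q := ⟨rfl⟩
  have h := Ideal.height_le_height_add_of_liesOver q (maximalIdeal C)
  have h0 : (Ideal.map (Ideal.Quotient.mk (q.map (algebraMap D C))) (maximalIdeal C)).height = 0 := by
    have : Nontrivial (C ⧸ q.map (algebraMap D C)) :=
      Ideal.Quotient.nontrivial_iff.2 (hq ▸ Ideal.IsPrime.ne_top')
    rw [(Ideal.map_mk_eq_bot_of_le hq.ge), Ideal.height_bot]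
  rw [h0, add_zero] at h
  rw [← maximalIdeal_height_eq_ringKrullDim]
  exact (WithBot.coe_le_coe.2 h).trans Ideal.height_le_ringKrullDim_of_isPrime

theorem radical_eq_maximalIdeal_of_ringKrullDim_quotient {C : Type*} [CommRing C] [IsLocalRing C]
    (I : Ideal C) (h : ringKrullDim (C ⧸ I) = 0) : I.radical = maximalIdeal C := by
  have h1 := support_of_supportDim_eq_zero (R := C) (N := C ⧸ I)
    ((Module.supportDim_quotient_eq_ringKrullDim I).trans h)
  rw [Module.support_eq_zeroLocus, Ideal.annihilator_quotient,
    PrimeSpectrum.zeroLocus_eq_iff] at h1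
  rw [h1, Ideal.IsPrime.radical inferInstance]

end IsLocalRing

theorem Module.supportDim_tensorProduct_of_isDomain {R C M : Type*} [CommRing R] [CommRing C]
    [IsDomain C] [Algebra R C] [AddCommGroup M] [Module R M] [Module.Finite R M]
    (h : PrimeSpectrum.comap (algebraMap R C) ⊥ ∈ Module.support R M) :
    Module.supportDim C (C ⊗[R] M) = ringKrullDim C := by
  let p := PrimeSpectrum.comap (algebraMap R C) ⊥
  let K := FractionRing C
  have hp : p.asIdeal = RingHom.ker (algebraMap R K) := by
    rw [IsScalarTower.algebraMap_eq R C K]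
    ext x
    simp [p, RingHom.mem_ker]
  let f : p.asIdeal.ResidueField →+* K := Ideal.ResidueField.lift p.asIdeal (algebraMap R K) hp.le (by
    intro x hx
    rw [Submonoid.mem_comap]
    exact IsUnit.mk0 _ fun h0 => hx (hp ▸ h0))
  let := f.toAlgebra
  have : IsScalarTower R p.asIdeal.ResidueField K := IsScalarTower.of_algebraMap_eq fun x =>
    (Ideal.ResidueField.lift_algebraMap _ _ _ _ x).symm
  have h1 := (Module.mem_support_iff_nontrivial_residueField_tensorProduct p).1 h
  have h2 : Nontrivial (K ⊗[p.asIdeal.ResidueField] (p.asIdeal.ResidueField ⊗[R] M)) :=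
    Module.FaithfullyFlat.lTensor_nontrivial _ _ _
  have h3 : Nontrivial (K ⊗[C] (C ⊗[R] M)) :=
    ((AlgebraTensorModule.cancelBaseChange R C K K M).trans
      (AlgebraTensorModule.cancelBaseChange R p.asIdeal.ResidueField K K M).symm).nontrivial
  have h4 : Module.annihilator C (C ⊗[R] M) = ⊥ := by
    rw [eq_bot_iff]
    intro c hc
    by_contra h0
    have hcK : algebraMap C K c ≠ 0 := fun h => h0 ((FaithfulSMul.algebraMap_eq_zero_iff C K).1 h)
    rw [Module.mem_annihilator] at hc
    refine not_subsingleton (K ⊗[C] (C ⊗[R] M)) (subsingleton_of_forall_eq 0 fun x => ?_)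
    induction x with
    | zero => rfl
    | add x y hx hy => rw [hx, hy, add_zero]
    | tmul k x =>
      have : k = c • ((algebraMap C K c)⁻¹ * k) := by
        rw [Algebra.smul_def, mul_inv_cancel_left₀ hcK]
      rw [this, TensorProduct.smul_tmul, hc, TensorProduct.tmul_zero]
  rw [Module.supportDim_eq_ringKrullDim_quotient_annihilator, h4]
  exact ringKrullDim_eq_of_ringEquiv (RingEquiv.quotientBot C)

theorem AdicCompletion.algebraMap_mem_annihilator {A N : Type*} [CommRing A] [AddCommGroup N]
    [Module A N] (I : Ideal A) (x : A) (hx : x ∈ Module.annihilator A N) :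
    algebraMap A (AdicCompletion I A) x ∈
      Module.annihilator (AdicCompletion I A) (AdicCompletion I N) := by
  rw [Module.mem_annihilator] at hx ⊢
  intro y
  rw [algebraMap_smul]
  ext n
  obtain ⟨z, hz⟩ := Submodule.Quotient.mk_surjective _ (y.val n)
  rw [AdicCompletion.val_smul_apply, ← hz, ← Submodule.Quotient.mk_smul, hx]
  rfl

/-- The main theorem, with the completion of `R_m` replaced by any Noetherian local
`R_m`-algebra `B` with the extended maximal ideal. -/
theorem not_finite_localizedModule_topLC {R B : Type} [CommRing R] [IsNoetherianRing R]
    [CommRing B] [IsLocalRing B] [IsNoetherianRing B] (a b m : Ideal R) [m.IsPrime]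
    [Algebra R B] [Algebra (Localization.AtPrime m) B] [IsScalarTower R (Localization.AtPrime m) B]
    (hmB : (IsLocalRing.maximalIdeal (Localization.AtPrime m)).map
      (algebraMap (Localization.AtPrime m) B) = IsLocalRing.maximalIdeal B)
    {d : ℕ} (hd : ringKrullDim (R ⧸ b) = d) (hd0 : 0 < d)
    (M : Type) [AddCommGroup M] [Module R M] [Module.Finite R M]
    (hassh : Assh R M = Assh R (R ⧸ b)) (q : Ideal B) [q.IsPrime]
    (hbq : b ≤ q.comap (algebraMap R B)) (hdim : ringKrullDim (B ⧸ q) = d)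
    (hdim0 : ringKrullDim (B ⧸ a.map (algebraMap R B) ⊔ q) = 0) :
    ¬ Module.Finite (Localization.AtPrime m) (LocalizedModule m.primeCompl (TopLC R a d M)) := by
  let p : Ideal R := q.comap (algebraMap R B)
  have : IsLocalRing (B ⧸ q) := IsLocalRing.of_surjective' _ Ideal.Quotient.mk_surjective
  have hmap : algebraMap R (B ⧸ q) = (Ideal.Quotient.mk q).comp (algebraMap R B) := rfl
  have hmC : m.map (algebraMap R (B ⧸ q)) = IsLocalRing.maximalIdeal (B ⧸ q) := by
    rw [hmap, ← Ideal.map_map, IsScalarTower.algebraMap_eq R (Localization.AtPrime m) B,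
      ← Ideal.map_map, Localization.AtPrime.map_eq_maximalIdeal, hmB]
    exact IsLocalRing.map_maximalIdeal_of_surjective _ Ideal.Quotient.mk_surjective
  have hrad : (a.map (algebraMap R (B ⧸ q))).radical = IsLocalRing.maximalIdeal (B ⧸ q) := by
    refine IsLocalRing.radical_eq_maximalIdeal_of_ringKrullDim_quotient _ ?_
    rw [hmap, ← Ideal.map_map, ringKrullDim_eq_of_ringEquiv (DoubleQuot.quotQuotEquivQuotSup q _),
      sup_comm, hdim0]
  have hdp : (d : WithBot ℕ∞) ≤ ringKrullDim (R ⧸ p) := by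
    let : Algebra (R ⧸ p) (B ⧸ q) := (Ideal.quotientMap q (algebraMap R B) le_rfl).toAlgebra
    rw [← hdim]
    refine IsLocalRing.ringKrullDim_le_of_map_eq_maximalIdeal (m.map (Ideal.Quotient.mk p)) ?_
    rw [Ideal.map_map, ← hmC]
    rfl
  have hdim_le {I J : Ideal R} (h : I ≤ J) : ringKrullDim (R ⧸ J) ≤ ringKrullDim (R ⧸ I) :=
    ringKrullDim_le_of_surjective (Ideal.Quotient.factor h) (Ideal.Quotient.factor_surjective h)
  have hRb : moduleDim R (R ⧸ b) = d :=
    (Module.supportDim_quotient_eq_ringKrullDim b).trans hd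
  obtain ⟨p', hp', hp'p⟩ := Ideal.exists_minimalPrimes_le hbq
  have hp'd : ringKrullDim (R ⧸ p') = d :=
    le_antisymm ((hdim_le hp'.1.2).trans hd.le) (hdp.trans (hdim_le hp'p))
  have hp'R : p' ∈ Assh R (R ⧸ b) := by
    refine ⟨Module.associatedPrimes.minimalPrimes_annihilator_subset_associatedPrimes R (R ⧸ b) ?_,
      hp'd.trans hRb.symm⟩
    rwa [Ideal.annihilator_quotient]
  obtain ⟨hp'M, hMd⟩ : p' ∈ Assh R M := hassh ▸ hp'R
  have hsupp : PrimeSpectrum.comap (algebraMap R (B ⧸ q)) ⊥ ∈ Module.support R M := by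
    rw [Module.mem_support_iff_of_finite]
    refine Submodule.annihilator_top.symm.le.trans ((IsAssociatedPrime.annihilator_le hp'M).trans (hp'p.trans fun x hx => ?_))
    exact Ideal.Quotient.eq_zero_iff_mem.2 hx
  obtain ⟨n, rfl⟩ : ∃ n, d = n + 1 := ⟨d - 1, by lia⟩
  obtain ⟨f, hf⟩ := LimExt.exists_localCohomology_surjective a n M
  exact LimExt.not_finite_localizedModule (H := TopLC R a (n + 1) M) (C := B ⧸ q) m.primeCompl hd0
    hrad (hMd.symm.trans hp'd).le
    ((Module.supportDim_tensorProduct_of_isDomain hsupp).trans hdim) f hf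

/-- For ideals `a`, `b` of a Noetherian ring `R` with `dim R/b = d > 0` finite,
any finitely generated module `M` with `Assh_R M = Assh_R(R/b)` and any `m ∈ P_{a,R/b}`,
the localization `(H^d_a(M))_m` is not a finitely generated `R_m`-module. -/
theorem stmt_8 (R : Type) [CommRing R] [IsNoetherianRing R] (a b : Ideal R)
    (d : ℕ) (hd : ringKrullDim (R ⧸ b) = (d : WithBot ℕ∞)) (hd0 : 0 < d)
    (M : Type) [AddCommGroup M] [Module R M] [Module.Finite R M]
    (hassh : Assh R M = Assh R (R ⧸ b))
    (m : PrimeSpectrum R) (hm : m ∈ Pset R a (R ⧸ b) d) :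
    ¬ Module.Finite (Localization.AtPrime m.asIdeal)
        (LocalizedModule m.asIdeal.primeCompl (TopLC R a d M)) := by
  obtain ⟨-, q, hq, hdim, hdim0⟩ := hm
  have := AdicCompletion.isNoetherianRing
    (IsLocalRing.maximalIdeal (Localization.AtPrime m.asIdeal))
  refine not_finite_localizedModule_topLC a b m.asIdeal AdicCompletion.maximalIdeal_eq_map.symm hd
    hd0 M hassh q.asIdeal (fun x hx => ?_) hdim ?_
  · refine Module.annihilator_le_of_mem_support hq ?_
    rw [IsScalarTower.algebraMap_apply R (Localization.AtPrime m.asIdeal)]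
    refine AdicCompletion.algebraMap_mem_annihilator _ _ ?_
    rw [Module.mem_annihilator]
    intro y
    rw [algebraMap_smul]
    induction y using LocalizedModule.induction_on with
    | h y s =>
      obtain ⟨r, rfl⟩ := Ideal.Quotient.mk_surjective y
      have h0 : x • Ideal.Quotient.mk b r = 0 :=
        Ideal.Quotient.eq_zero_iff_mem.2 (b.mul_mem_right r hx)
      rw [LocalizedModule.smul'_mk, h0, LocalizedModule.zero_mk]
  · rw [Ideal.map_map, ← IsScalarTower.algebraMap_eq] at hdim0
    exact hdim0
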